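/- Let (X, τ) be a regular Hausdorff topological space which is not left-separated and has a point-countable basis. Let K be a positive natural number and let c be a colouring assigning to each unordered pair of distinct elements of X a colour in {0,…,K−1}. Then there is Y ⊆ X homeomorphic to ℚ such that c takes at most 2 values on unordered pairs of distinct elements of Y, i.e. |c''[Y]²| ≤ 2. -/

import Mathlib

/-- The set of colours taken by the pair-colouring `c` on unordered pairs of
distinct elements of `Y`, i.e. `c''[Y]²`. -/
def pairColours {X : Type*} {K : ℕ} (c : Sym2 X → Fin K) (Y : Set X) : Set (Fin K) :=
  {k | ∃ x ∈ Y, ∃ y ∈ Y, x ≠ y ∧ c s(x, y) = k}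

/-- A topological space is left-separated if it carries a well-ordering all of whose proper
initial segments are closed. -/
def LeftSeparated (X : Type*) [TopologicalSpace X] : Prop :=
  ∃ r : X → X → Prop, IsWellOrder X r ∧ ∀ x : X, IsClosed {y : X | r y x}

open Set Topology

/-! ### Countable metrizable spaces without isolated points -/

section Sierpinski

/-- Every neighbourhood of a point of a countable metrizable space contains a clopen one. -/
theorem exists_isClopen_subset_of_countable {X : Type*} [TopologicalSpace X] [Countable X]
    [TopologicalSpace.MetrizableSpace X] {x : X} {U : Set X} (hU : U ∈ 𝓝 x) :
    ∃ V, IsClopen V ∧ x ∈ V ∧ V ⊆ U := by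
  let := TopologicalSpace.metrizableSpaceMetric X
  obtain ⟨ε, hε, hεU⟩ := Metric.mem_nhds_iff.1 hU
  have hc : (range (dist · x : X → ℝ)).Countable := countable_range _
  obtain ⟨r, hr, hr'⟩ : ∃ r ∈ Ioo 0 ε, r ∉ range (dist · x : X → ℝ) := by
    by_contra! h
    exact (Cardinal.Real.Ioo_countable_iff.not.2 (by simpa using hε)) (hc.mono h)
  have hball : Metric.ball x r = Metric.closedBall x r := by
    ext z
    have : dist z x ≠ r := fun h => hr' ⟨z, h⟩
    simp only [Metric.mem_ball, Metric.mem_closedBall]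
    exact ⟨le_of_lt, fun h => lt_of_le_of_ne h this⟩
  refine ⟨Metric.ball x r, ⟨?_, Metric.isOpen_ball⟩, Metric.mem_ball_self hr.1,
    (Metric.ball_subset_ball hr.2.le).trans hεU⟩
  rw [hball]
  exact Metric.isClosed_closedBall

/-- In a countable metrizable space a non-isolated point of a clopen set `C` has a strictly
decreasing neighbourhood base of clopen sets starting with `C`. -/
theorem exists_strictAnti_clopen_base {X : Type*} [TopologicalSpace X] [Countable X]
    [TopologicalSpace.MetrizableSpace X] (hX : ∀ x : X, (𝓝[≠] x).NeBot)
    {C : Set X} (hC : IsClopen C) {y : X} (hy : y ∈ C) :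
    ∃ W : ℕ → Set X, W 0 = C ∧ (∀ n, IsClopen (W n)) ∧ (∀ n, y ∈ W n) ∧
      (∀ n, W (n + 1) ⊂ W n) ∧ ∀ U ∈ 𝓝 y, ∃ n, W n ⊆ U := by
  obtain ⟨B, hB⟩ := (𝓝 y).exists_antitone_basis
  have step : ∀ (n : ℕ) (W : {W : Set X // IsClopen W ∧ y ∈ W}),
      ∃ V : {W : Set X // IsClopen W ∧ y ∈ W}, V.1 ⊂ W.1 ∧ V.1 ⊆ B n := by
    rintro n ⟨W, hW, hyW⟩
    have hWn : W ∈ 𝓝 y := hW.isOpen.mem_nhds hyW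
    obtain ⟨z, hz, hzy⟩ : ∃ z ∈ W, z ≠ y := by
      have := (hX y).nonempty_of_mem (inter_mem_nhdsWithin {y}ᶜ hWn)
      obtain ⟨z, hz⟩ := this
      exact ⟨z, hz.2, hz.1⟩
    have : W ∩ B n ∩ {z}ᶜ ∈ 𝓝 y :=
      Filter.inter_mem (Filter.inter_mem hWn (hB.mem n))
        (isOpen_compl_singleton.mem_nhds (by simpa using hzy.symm))
    obtain ⟨V, hV, hyV, hVU⟩ := exists_isClopen_subset_of_countable this
    refine ⟨⟨V, hV, hyV⟩, ⟨fun v hv => (hVU hv).1.1, fun h => (hVU (h hz)).2 rfl⟩,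
      fun v hv => (hVU hv).1.2⟩
  choose next hnext₁ hnext₂ using step
  let W : ℕ → {W : Set X // IsClopen W ∧ y ∈ W} := fun n => Nat.rec ⟨C, hC, hy⟩ next n
  refine ⟨fun n => (W n).1, rfl, fun n => (W n).2.1, fun n => (W n).2.2,
    fun n => hnext₁ n (W n), fun U hU => ?_⟩
  obtain ⟨n, hn⟩ := hB.mem_iff.1 hU
  exact ⟨n + 1, (hnext₂ n (W n)).trans hn⟩

/-- A countable metrizable space without isolated points can be coded by the tree of finite
sequences of naturals: its open sets are those which with any node contain almost all cones above
children of that node. -/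
theorem exists_listNat_coding {X : Type*} [TopologicalSpace X] [Countable X] [Nonempty X]
    [TopologicalSpace.MetrizableSpace X] (hX : ∀ x : X, (𝓝[≠] x).NeBot) :
    ∃ f : List ℕ → X, Function.Bijective f ∧ ∀ U : Set X,
      IsOpen U ↔ ∀ s, f s ∈ U → ∃ N, ∀ n ≥ N, ∀ w, n :: s <:+ w → f w ∈ U := by
  obtain ⟨e, he⟩ := exists_injective_nat X
  have hmin : ∀ C : {C : Set X // IsClopen C ∧ C.Nonempty},
      ∃ y ∈ C.1, ∀ z ∈ C.1, e y ≤ e z := fun C => by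
    obtain ⟨-, ⟨⟨y, hy, rfl⟩, h⟩⟩ := wellFounded_lt.has_min (e '' C.1) (C.2.2.image e)
    exact ⟨y, hy, fun z hz => not_lt.1 (h _ (mem_image_of_mem e hz))⟩
  choose pt hpt hptmin using hmin
  choose W hW0 hWc hWy hWs hWb using fun C : {C : Set X // IsClopen C ∧ C.Nonempty} =>
    exists_strictAnti_clopen_base hX C.2.1 (hpt C)
  have hanti : ∀ C, Antitone (W C) := fun C => antitone_nat_of_succ_le fun n => (hWs C n).1
  let child : ℕ → {C : Set X // IsClopen C ∧ C.Nonempty} → {C : Set X // IsClopen C ∧ C.Nonempty} :=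
    fun n C => ⟨W C n \ W C (n + 1), (hWc C n).diff (hWc C (n + 1)),
      nonempty_of_ssubset (hWs C n)⟩
  let T : List ℕ → {C : Set X // IsClopen C ∧ C.Nonempty} := fun s =>
    List.rec ⟨univ, isClopen_univ, univ_nonempty⟩ (fun n _ C => child n C) s
  have hTcons : ∀ n s, (T (n :: s)).1 = W (T s) n \ W (T s) (n + 1) := fun n s => rfl
  have hTsub : ∀ n s, (T (n :: s)).1 ⊆ (T s).1 := fun n s => by
    rw [hTcons]
    exact sdiff_subset.trans ((hanti _ (Nat.zero_le n)).trans (hW0 _).le)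
  have hTmono : ∀ s w, s <:+ w → (T w).1 ⊆ (T s).1 := by
    rintro s w ⟨l, rfl⟩
    induction l with
    | nil => exact subset_rfl
    | cons n l ih => exact (hTsub n (l ++ s)).trans ih
  let f : List ℕ → X := fun s => pt (T s)
  have hfT : ∀ s, f s ∈ (T s).1 := fun s => hpt _
  have hfc : ∀ n s, f s ∉ (T (n :: s)).1 := fun n s h => h.2 (hWy _ _)
  have hsuf : ∀ s w : List ℕ, s <:+ w → w = s ∨ ∃ n, n :: s <:+ w := by
    rintro s w ⟨l, rfl⟩
    rcases l.eq_nil_or_concat with rfl | ⟨l, n, rfl⟩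
    · exact Or.inl rfl
    · exact Or.inr ⟨n, l, by simp⟩
  have hchild : ∀ s z, z ∈ (T s).1 → z ≠ f s → ∃ n, z ∈ (T (n :: s)).1 := by
    intro s z hz hzs
    obtain ⟨n, hn⟩ := hWb (T s) {z}ᶜ (isOpen_compl_singleton.mem_nhds (by simpa using hzs.symm))
    classical
    have hex : ∃ n, z ∉ W (T s) n := ⟨n, fun h => hn h rfl⟩
    have h0 : Nat.find hex ≠ 0 := fun h => by
      have := Nat.find_spec hex
      rw [h, hW0] at this
      exact this hz
    obtain ⟨m, hm⟩ := Nat.exists_eq_succ_of_ne_zero h0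
    refine ⟨m, ?_, ?_⟩
    · by_contra h
      exact absurd (Nat.find_min' hex h) (by omega)
    · have := Nat.find_spec hex
      rwa [hm] at this
  have huniq : ∀ s z m n, z ∈ (T (m :: s)).1 → z ∈ (T (n :: s)).1 → m = n := by
    intro s z m n hm hn
    by_contra hne
    rcases lt_or_gt_of_ne hne with h | h
    · exact hm.2 (hanti _ (Nat.succ_le_of_lt h) hn.1)
    · exact hn.2 (hanti _ (Nat.succ_le_of_lt h) hm.1)
  have hlt : ∀ n s, e (f s) < e (f (n :: s)) := fun n s =>
    lt_of_le_of_ne (hptmin _ _ (hTsub n s (hfT (n :: s)))) fun h =>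
      hfc n s (by rw [he h]; exact hfT (n :: s))
  have hcode : ∀ k s z, z ∈ (T s).1 → e z < e (f s) + k → ∃! w, s <:+ w ∧ f w = z := by
    intro k
    induction k with
    | zero => exact fun s z hz h => absurd (hptmin _ _ hz) (by simpa using h)
    | succ k ih =>
      intro s z hz hk
      by_cases hzs : z = f s
      · refine ⟨s, ⟨List.suffix_rfl, hzs.symm⟩, ?_⟩
        rintro w ⟨hw, hwz⟩
        rcases hsuf s w hw with rfl | ⟨n, hn⟩
        · rfl
        · exact absurd (hTmono _ _ hn (hfT w)) (by rw [hwz, hzs]; exact hfc n s)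
      · obtain ⟨n, hn⟩ := hchild s z hz hzs
        obtain ⟨w, ⟨hw, hwz⟩, hwu⟩ := ih (n :: s) z hn (by have := hlt n s; omega)
        refine ⟨w, ⟨(List.suffix_cons n s).trans hw, hwz⟩, ?_⟩
        rintro v ⟨hv, hvz⟩
        rcases hsuf s v hv with rfl | ⟨m, hm⟩
        · exact absurd hvz.symm hzs
        · have : m = n := huniq s z m n (hvz ▸ hTmono _ _ hm (hfT v)) hn
          exact hwu v ⟨this ▸ hm, hvz⟩
  have hcode' : ∀ s z, z ∈ (T s).1 → ∃! w, s <:+ w ∧ f w = z := fun s z hz =>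
    hcode (e z + 1) s z hz (by omega)
  refine ⟨f, Function.bijective_iff_existsUnique f |>.2 fun z => ?_,
    fun U => ⟨fun hU s hs => ?_, fun h => ?_⟩⟩
  · simpa using hcode' [] z (mem_univ z)
  · obtain ⟨N, hN⟩ := hWb (T s) U (hU.mem_nhds hs)
    exact ⟨N, fun n hn w hw => hN (hanti _ hn (hTmono _ _ hw (hfT w)).1)⟩
  · rw [isOpen_iff_mem_nhds]
    intro z hz
    obtain ⟨s, ⟨-, rfl⟩, -⟩ := hcode' [] z (mem_univ z)
    obtain ⟨N, hN⟩ := h s hz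
    refine Filter.mem_of_superset ((hWc (T s) N).isOpen.mem_nhds (hWy _ _)) fun v hv => ?_
    by_cases hvs : v = f s
    · exact hvs ▸ hz
    · obtain ⟨n, hn⟩ := hchild s v ((hW0 (T s)).le (hanti _ (Nat.zero_le N) hv)) hvs
      obtain ⟨w, ⟨hw, rfl⟩, -⟩ := hcode' (n :: s) v hn
      refine hN n ?_ w hw
      by_contra hlt
      exact hn.2 (hanti _ (by omega) hv)

/-- **Sierpiński's theorem**: a nonempty countable metrizable space without isolated points is
homeomorphic to the rationals. -/
theorem nonempty_homeomorph_rat {X : Type*} [TopologicalSpace X] [Countable X] [Nonempty X]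
    [TopologicalSpace.MetrizableSpace X] (hX : ∀ x : X, (𝓝[≠] x).NeBot) :
    Nonempty (X ≃ₜ ℚ) := by
  obtain ⟨f, hf, hfo⟩ := exists_listNat_coding hX
  obtain ⟨g, hg, hgo⟩ := exists_listNat_coding (X := ℚ) fun x => inferInstance
  let F := Equiv.ofBijective f hf
  let G := Equiv.ofBijective g hg
  have hFG : ∀ s, F.symm (f s) = s := F.symm_apply_apply
  have hGF : ∀ s, G.symm (g s) = s := G.symm_apply_apply
  refine ⟨⟨F.symm.trans G, ⟨fun U hU => ?_⟩, ⟨fun U hU => ?_⟩⟩⟩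
  · rw [hfo]
    rw [hgo] at hU
    intro s hs
    simpa [hFG, G] using hU s (by simpa [hFG, G] using hs)
  · rw [hgo]
    rw [hfo] at hU
    intro s hs
    simpa [hGF, F] using hU s (by simpa [hGF, F] using hs)

end Sierpinski

universe u

namespace Galvin

/-! ### Normal ideals of pairs -/

/-- Finite terms built from natural numbers and points of `X`. -/
inductive Term (X : Type u) : Type u
  | nat : ℕ → Term X
  | pt : X → Term X
  | pair : Term X → Term X → Term X

/-- The points occurring in a term lie in `a`. -/
def Term.Over {X : Type u} (a : Set X) : Term X → Prop
  | .nat _ => True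
  | .pt x => x ∈ a
  | .pair s t => s.Over a ∧ t.Over a

theorem Term.Over.mono {X : Type u} {a b : Set X} (h : a ⊆ b) :
    ∀ {t : Term X}, t.Over a → t.Over b
  | .nat _, _ => trivial
  | .pt _, ht => h ht
  | .pair _ _, ht => ⟨ht.1.mono h, ht.2.mono h⟩

/-- The diagonal union of a family of sets of pairs `(a, x)` indexed by terms. -/
def diag {X : Type u} (E : Term X → Set (Set X × X)) : Set (Set X × X) :=
  {ω | ∃ t : Term X, t.Over ω.1 ∧ ω ∈ E t}

/-- An ideal of sets of pairs `(a, x)` is normal if it is closed under diagonal unions, contains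
the sets `{(a, x) | z ∉ a}`, and is concentrated on the pairs with `x ∈ closure a \ a`. -/
structure IsNormal {X : Type u} [TopologicalSpace X] (J : Set (Set (Set X × X))) : Prop where
  mono : ∀ {A B : Set (Set X × X)}, A ⊆ B → B ∈ J → A ∈ J
  diag_mem : ∀ E : Term X → Set (Set X × X), (∀ t, E t ∈ J) → diag E ∈ J
  fine : ∀ z : X, {ω : Set X × X | z ∉ ω.1} ∈ J
  limit : {ω : Set X × X | ¬(ω.2 ∈ closure ω.1 ∧ ω.2 ∉ ω.1)} ∈ J

namespace IsNormal

variable {X : Type u} [TopologicalSpace X] {J : Set (Set (Set X × X))}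

theorem empty_mem (hJ : IsNormal J) : ∅ ∈ J := hJ.mono (empty_subset _) hJ.limit

theorem iUnion_nat_mem (hJ : IsNormal J) {Z : ℕ → Set (Set X × X)} (hZ : ∀ n, Z n ∈ J) :
    ⋃ n, Z n ∈ J := by
  let E : Term X → Set (Set X × X)
    | .nat n => Z n
    | _ => ∅
  refine hJ.mono ?_ (hJ.diag_mem E ?_)
  · rintro ω hω
    obtain ⟨n, hn⟩ := mem_iUnion.1 hω
    exact ⟨.nat n, trivial, hn⟩
  · rintro (n | x | ⟨s, t⟩)
    exacts [hZ n, hJ.empty_mem, hJ.empty_mem]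

theorem iUnion_mem (hJ : IsNormal J) {ι : Type*} [Countable ι] {Z : ι → Set (Set X × X)}
    (hZ : ∀ i, Z i ∈ J) : ⋃ i, Z i ∈ J := by
  rcases isEmpty_or_nonempty ι with h | h
  · simpa using hJ.empty_mem
  · obtain ⟨e, he⟩ := exists_surjective_nat ι
    exact hJ.mono (he.iUnion_comp Z).ge (hJ.iUnion_nat_mem fun n => hZ (e n))

theorem union_mem (hJ : IsNormal J) {A B : Set (Set X × X)} (hA : A ∈ J) (hB : B ∈ J) :
    A ∪ B ∈ J := by
  rw [union_eq_iUnion]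
  exact hJ.iUnion_mem (by rintro (_ | _) <;> assumption)

/-- A positive set contains a pair avoiding all the given null sets indexed by terms over its
first coordinate. -/
theorem exists_generic (hJ : IsNormal J) {A : Set (Set X × X)} (hA : A ∉ J)
    (E : Term X → Set (Set X × X)) :
    ∃ ω ∈ A, ∀ t : Term X, t.Over ω.1 → E t ∈ J → ω ∉ E t := by
  classical
  by_contra! h
  refine hA (hJ.mono ?_ (hJ.diag_mem (fun t => if E t ∈ J then E t else ∅) fun t => ?_))
  · intro ω hω
    obtain ⟨t, ht, htJ, hωt⟩ := h ω hω
    exact ⟨t, ht, by simpa [htJ] using hωt⟩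
  · split_ifs with ht
    exacts [ht, hJ.empty_mem]

end IsNormal

/-! ### Hulls of term operations -/

section Hull

variable {X : Type u}

/-- A set is closed under the operation `G` on terms. -/
def TermClosed (G : Term X → X) (a : Set X) : Prop := ∀ t : Term X, t.Over a → G t ∈ a

/-- The closure of a set under an operation on terms. -/
def termHull (G : Term X → X) (S : Set X) : Set X := ⋂₀ {a | S ⊆ a ∧ TermClosed G a}

theorem subset_termHull (G : Term X → X) (S : Set X) : S ⊆ termHull G S :=
  subset_sInter fun _ h => h.1

theorem termHull_subset {G : Term X → X} {S a : Set X} (h : S ⊆ a) (ha : TermClosed G a) :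
    termHull G S ⊆ a := sInter_subset_of_mem ⟨h, ha⟩

theorem termClosed_termHull (G : Term X → X) (S : Set X) : TermClosed G (termHull G S) :=
  fun t ht _ ha => ha.2 t (ht.mono (termHull_subset ha.1 ha.2))

theorem termHull_mono (G : Term X → X) {S T : Set X} (h : S ⊆ T) : termHull G S ⊆ termHull G T :=
  termHull_subset (h.trans (subset_termHull G T)) (termClosed_termHull G T)

theorem Term.Over.exists_of_iUnion {ι : Type*} [LinearOrder ι] [Nonempty ι] {H : ι → Set X}
    (hH : Monotone H) : ∀ {t : Term X}, t.Over (⋃ i, H i) → ∃ i, t.Over (H i)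
  | .nat _, _ => ⟨Classical.arbitrary ι, trivial⟩
  | .pt _, ht => mem_iUnion.1 ht
  | .pair _ _, ht => by
    obtain ⟨i, hi⟩ := Term.Over.exists_of_iUnion hH ht.1
    obtain ⟨j, hj⟩ := Term.Over.exists_of_iUnion hH ht.2
    exact ⟨max i j, hi.mono (hH (le_max_left i j)), hj.mono (hH (le_max_right i j))⟩

theorem TermClosed.iUnion {ι : Type*} [LinearOrder ι] [Nonempty ι] {G : Term X → X}
    {H : ι → Set X} (hH : Monotone H) (h : ∀ i, TermClosed G (H i)) :
    TermClosed G (⋃ i, H i) := fun t ht => by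
  obtain ⟨i, hi⟩ := Term.Over.exists_of_iUnion hH ht
  exact mem_iUnion.2 ⟨i, h i t hi⟩

theorem termHull_iUnion {ι : Type*} [LinearOrder ι] [Nonempty ι] (G : Term X → X)
    {H : ι → Set X} (hH : Monotone H) :
    termHull G (⋃ i, H i) = ⋃ i, termHull G (H i) := by
  refine Subset.antisymm (termHull_subset (iUnion_mono fun i => subset_termHull G _) ?_)
    (iUnion_subset fun i => termHull_mono G (subset_iUnion H i))
  exact TermClosed.iUnion (fun i j hij => termHull_mono G (hH hij))
    fun i => termClosed_termHull G _

theorem countable_setOf_over {a : Set X} (ha : a.Countable) :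
    {t : Term X | t.Over a}.Countable := by
  let D : ℕ → Set (Term X) := fun n => Nat.rec (range Term.nat ∪ Term.pt '' a)
    (fun _ D => D ∪ image2 Term.pair D D) n
  have hD : ∀ n, (D n).Countable := fun n => by
    induction n with
    | zero => exact (countable_range _).union (ha.image _)
    | succ n ih => exact ih.union (ih.image2 ih _)
  have hmono : Monotone D := monotone_nat_of_le_succ fun n => subset_union_left
  refine (countable_iUnion hD).mono fun t => ?_
  induction t with
  | nat n => exact fun _ => mem_iUnion.2 ⟨0, Or.inl ⟨n, rfl⟩⟩
  | pt x => exact fun h => mem_iUnion.2 ⟨0, Or.inr ⟨x, h, rfl⟩⟩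
  | pair s t hs ht =>
    intro h
    obtain ⟨m, hm⟩ := mem_iUnion.1 (hs h.1)
    obtain ⟨n, hn⟩ := mem_iUnion.1 (ht h.2)
    exact mem_iUnion.2 ⟨max m n + 1, Or.inr ⟨s, hmono (le_max_left m n) hm, t,
      hmono (le_max_right m n) hn, rfl⟩⟩

theorem countable_termHull (G : Term X → X) {S : Set X} (hS : S.Countable) :
    (termHull G S).Countable := by
  let a : ℕ → Set X := fun n => Nat.rec S (fun _ a => a ∪ G '' {t | t.Over a}) n
  have ha : ∀ n, (a n).Countable := fun n => by
    induction n with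
    | zero => exact hS
    | succ n ih => exact ih.union ((countable_setOf_over ih).image G)
  have hmono : Monotone a := monotone_nat_of_le_succ fun n => subset_union_left
  refine (countable_iUnion ha).mono (termHull_subset (subset_iUnion a 0) fun t ht => ?_)
  obtain ⟨n, hn⟩ := Term.Over.exists_of_iUnion hmono ht
  exact mem_iUnion.2 ⟨n + 1, Or.inr ⟨t, hn, rfl⟩⟩

theorem exists_chain_mk_lt {S : Set X} (hS : ¬ S.Countable) :
    ∃ (ι : Type u) (_ : LinearOrder ι) (_ : WellFoundedLT ι) (_ : Nonempty ι) (g : ι → Set X),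
      Monotone g ∧ ⋃ i, g i = S ∧ ∀ i, Cardinal.mk (g i) < Cardinal.mk S := by
  have hinf : Cardinal.aleph0 < Cardinal.mk S := by
    rwa [← not_le, Cardinal.le_aleph0_iff_set_countable]
  obtain ⟨e⟩ : Nonempty ((Cardinal.mk S).ord.ToType ≃ S) := Cardinal.eq.1 (by simp)
  have : Nonempty S := Cardinal.mk_ne_zero_iff.1 (pos_of_gt hinf).ne'
  refine ⟨(Cardinal.mk S).ord.ToType, inferInstance, inferInstance,
    ⟨e.symm (Classical.arbitrary S)⟩,
    fun i => (fun j => (e j : X)) '' Iic i, fun i j hij => image_mono (Iic_subset_Iic.2 hij),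
    ?_, fun i => ?_⟩
  · ext x
    simp only [mem_iUnion, mem_image, mem_Iic]
    exact ⟨fun ⟨i, j, _, h⟩ => h ▸ (e j).2, fun h => ⟨e.symm ⟨x, h⟩, _, le_rfl, by simp⟩⟩
  · refine Cardinal.mk_image_le.trans_lt ?_
    rw [← Iio_insert]
    refine (Cardinal.mk_insert_le).trans_lt ?_
    exact Cardinal.add_lt_of_lt hinf.le (by simpa using Cardinal.mk_Iio_lt i)
      (Cardinal.one_lt_aleph0.trans hinf)

variable [TopologicalSpace X] [T1Space X]

/-- If all sets closed under an operation on terms are topologically closed, then hulls can be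
enumerated over any closed set with closed initial segments. -/
theorem exists_rank_of_termClosed_isClosed {G : Term X → X}
    (hG : ∀ a, TermClosed G a → IsClosed a) (κ : Cardinal.{u}) :
    ∀ S C : Set X, Cardinal.mk S = κ → IsClosed C → ∃ ρ : X → Ordinal.{u},
      InjOn ρ (termHull G S \ C) ∧
      ∀ x ∈ termHull G S \ C, IsClosed (C ∪ {y ∈ termHull G S \ C | ρ y < ρ x}) := by
  classical
  induction κ using WellFoundedLT.induction with
  | ind κ ih =>
  rintro S C rfl hC
  by_cases hS : S.Countable
  · have hc : (termHull G S).Countable := countable_termHull G hS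
    obtain ⟨e, he⟩ := countable_iff_exists_injOn.1 hc
    refine ⟨fun x => (e x : Ordinal.{u}), fun x hx y hy h =>
      he hx.1 hy.1 (Nat.cast_injective (R := Ordinal.{u}) h),
      fun x _ => hC.union (Set.Finite.isClosed ?_)⟩
    refine Finite.of_finite_image ((finite_lt_nat (e x)).subset ?_)
      (he.mono fun y hy => hy.1.1)
    rintro _ ⟨y, hy, rfl⟩
    simpa using hy.2
  obtain ⟨ι, _, _, _, g, hg, rfl, hlt⟩ := exists_chain_mk_lt hS
  have hhull := termHull_iUnion G hg
  let D : ι → Set X := fun j => C ∪ ⋃ i : Iio j, termHull G (g i)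
  have hD : ∀ j, IsClosed (D j) := fun j => by
    refine hC.union ?_
    rcases isEmpty_or_nonempty (Iio j) with h | h
    · simp
    · exact hG _ (TermClosed.iUnion (fun i k hik => termHull_mono G (hg hik))
        fun i => termClosed_termHull G _)
  choose ρ hρ hρc using fun j => ih _ (hlt j) (g j) (D j) rfl (hD j)
  let i : X → ι := fun x =>
    if h : ∃ j, x ∈ termHull G (g j) then wellFounded_lt.min {j | x ∈ termHull G (g j)} h
    else Classical.arbitrary ι
  have hi : ∀ x j, x ∈ termHull G (g j) → x ∈ termHull G (g (i x)) ∧ i x ≤ j := fun x j hj => by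
    have h : ∃ j, x ∈ termHull G (g j) := ⟨j, hj⟩
    simp only [i, dif_pos h]
    exact ⟨wellFounded_lt.min_mem {j | x ∈ termHull G (g j)} h,
      not_lt.1 (wellFounded_lt.not_lt_min {j | x ∈ termHull G (g j)} hj)⟩
  have hiS : ∀ x ∈ termHull G (⋃ j, g j), x ∈ termHull G (g (i x)) := fun x hx => by
    rw [hhull] at hx
    obtain ⟨j, hj⟩ := mem_iUnion.1 hx
    exact (hi x j hj).1
  have hmem : ∀ x j, x ∈ termHull G (g j) \ D j ↔
      x ∈ termHull G (⋃ j, g j) \ C ∧ i x = j := fun x j => by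
    constructor
    · rintro ⟨hx, hxD⟩
      obtain ⟨h₁, h₂⟩ := hi x j hx
      refine ⟨⟨hhull ▸ mem_iUnion.2 ⟨j, hx⟩, fun h => hxD (Or.inl h)⟩, ?_⟩
      exact h₂.eq_of_not_lt fun h => hxD (Or.inr (mem_iUnion.2 ⟨⟨i x, h⟩, h₁⟩))
    · rintro ⟨⟨hx, hxC⟩, rfl⟩
      refine ⟨hiS x hx, ?_⟩
      rintro (h | h)
      · exact hxC h
      · obtain ⟨⟨k, hk⟩, hxk⟩ := mem_iUnion.1 h
        exact absurd (hi x k hxk).2 (not_le.2 hk)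
  let Y : Set X := termHull G (⋃ j, g j) \ C
  let f : Y → ι ×ₗ Ordinal.{u} := fun x => toLex (i x, ρ (i x) x)
  have hf : Function.Injective f := fun x y h => by
    have h' : (i x, ρ (i x) x) = (i y, ρ (i y) y) := h
    rw [Prod.mk.injEq] at h'
    refine Subtype.ext (hρ (i x) ((hmem x _).2 ⟨x.2, rfl⟩) ((hmem y _).2 ⟨y.2, h'.1.symm⟩) ?_)
    rw [h'.2, h'.1]
  let r : Y → Y → Prop := fun x y => f x < f y
  have hr : IsWellOrder Y r :=
    (⟨⟨f, hf⟩, Iff.rfl⟩ : r ↪r ((· < ·) : ι ×ₗ Ordinal.{u} → _ → Prop)).isWellOrder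
  refine ⟨fun x => if h : x ∈ Y then Ordinal.typein r ⟨x, h⟩ else 0, fun x hx y hy h => ?_,
    fun x hx => ?_⟩
  · simp only [Y, dif_pos hx, dif_pos hy] at h
    exact congrArg Subtype.val (Ordinal.typein_injective r h)
  · convert hρc (i x) x ((hmem x _).2 ⟨hx, rfl⟩) using 1
    ext y
    constructor
    · rintro (hy | ⟨hy, hyx⟩)
      · exact Or.inl (Or.inl hy)
      · simp only [dif_pos (show x ∈ Y from hx), dif_pos (show y ∈ Y from hy)] at hyx
        have h := (Ordinal.typein_lt_typein r).1 hyx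
        rcases Prod.Lex.toLex_lt_toLex.1 h with h | ⟨h₁, h₂⟩
        · exact Or.inl (Or.inr (mem_iUnion.2 ⟨⟨i y, h⟩, hiS y hy.1⟩))
        · refine Or.inr ⟨(hmem y _).2 ⟨hy, h₁⟩, ?_⟩
          simp only at h₁ h₂
          rwa [h₁] at h₂
    · rintro ((hy | hy) | ⟨hy, hyx⟩)
      · exact Or.inl hy
      · by_cases hyC : y ∈ C
        · exact Or.inl hyC
        obtain ⟨⟨k, hk⟩, hyk⟩ := mem_iUnion.1 hy
        have hyY : y ∈ Y := ⟨hhull ▸ mem_iUnion.2 ⟨k, hyk⟩, hyC⟩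
        refine Or.inr ⟨hyY, ?_⟩
        simp only [dif_pos (show x ∈ Y from hx), dif_pos hyY]
        exact (Ordinal.typein_lt_typein r).2
          (Prod.Lex.toLex_lt_toLex.2 (Or.inl ((hi y k hyk).2.trans_lt hk)))
      · obtain ⟨hyY, hyi⟩ := (hmem y _).1 hy
        refine Or.inr ⟨hyY, ?_⟩
        simp only [dif_pos (show x ∈ Y from hx), dif_pos (show y ∈ Y from hyY)]
        refine (Ordinal.typein_lt_typein r).2 (Prod.Lex.toLex_lt_toLex.2 (Or.inr ⟨hyi, ?_⟩))
        simp only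
        rwa [hyi]

theorem leftSeparated_of_termClosed_isClosed {G : Term X → X}
    (hG : ∀ a, TermClosed G a → IsClosed a) : LeftSeparated X := by
  obtain ⟨ρ, hρ, hρc⟩ := exists_rank_of_termClosed_isClosed hG _ univ ∅ rfl isClosed_empty
  have huniv : termHull G univ = univ := univ_subset_iff.1 (subset_termHull G univ)
  simp only [huniv, sdiff_empty, injOn_univ, mem_univ, true_and, empty_union, forall_true_left]
    at hρ hρc
  exact ⟨fun x y => ρ x < ρ y,
    (⟨⟨ρ, hρ⟩, Iff.rfl⟩ : (fun x y => ρ x < ρ y) ↪r ((· < ·) : Ordinal.{u} → _ → Prop)).isWellOrder,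
    hρc⟩

end Hull

/-! ### The ideal of a space which is not left-separated -/

section BaseIdeal

variable (X : Type u) [TopologicalSpace X]

/-- The sets of pairs `(a, x)` which, for some operation on terms, contain no pair with `a` closed
under this operation and `x ∈ closure a \ a`. -/
def baseIdeal : Set (Set (Set X × X)) :=
  {Z | ∃ G : Term X → X, ∀ ω ∈ Z, TermClosed G ω.1 → ¬(ω.2 ∈ closure ω.1 ∧ ω.2 ∉ ω.1)}

variable {X}

theorem isNormal_baseIdeal [Nonempty X] : IsNormal (baseIdeal X) where
  mono hAB := fun ⟨G, hG⟩ => ⟨G, fun ω hω => hG ω (hAB hω)⟩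
  diag_mem E hE := by
    choose G hG using hE
    let G' : Term X → X
      | .pair t s => G t s
      | t => G t t
    refine ⟨G', ?_⟩
    rintro ω ⟨t, ht, hωt⟩ hω
    exact hG t ω hωt fun s hs => hω (.pair t s) ⟨ht, hs⟩
  fine z := ⟨fun _ => z, fun ω hω h => absurd (h (.nat 0) trivial) hω⟩
  limit := ⟨fun _ => Classical.arbitrary X, fun _ hω _ => hω⟩

theorem univ_notMem_baseIdeal [T1Space X] (hX : ¬ LeftSeparated X) : univ ∉ baseIdeal X := by
  rintro ⟨G, hG⟩
  refine hX (leftSeparated_of_termClosed_isClosed (G := G) fun a ha =>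
    isClosed_of_closure_subset fun x hx => ?_)
  by_contra hxa
  exact hG (a, x) (mem_univ _) ha ⟨hx, hxa⟩

end BaseIdeal

/-! ### Domination between positive sets -/

section Domination

variable {X : Type u} {κ : Type} (c : Sym2 X → κ)

/-- The pairs whose second coordinate is joined to `z` by the colour `p`. -/
def colourNhd (z : X) (p : κ) : Set (Set X × X) := {ω | c s(z, ω.2) = p}

/-- For every `L`-positive `B' ⊆ B`, all but `J`-few points of `A` are joined by the colour `p` to
`L`-positively many points of `B'`. -/
def Dominates (p : κ) (A : Set (Set X × X)) (J : Set (Set (Set X × X))) (B : Set (Set X × X))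
    (L : Set (Set (Set X × X))) : Prop :=
  ∀ B' ⊆ B, B' ∉ L → {ω ∈ A | colourNhd c ω.2 p ∩ B' ∈ L} ∈ J

variable {c} {p : κ} {A A' B B' : Set (Set X × X)} {J J' L : Set (Set (Set X × X))}

theorem Dominates.mono_right (h : Dominates c p A J B L) (hB : B' ⊆ B) : Dominates c p A J B' L :=
  fun B'' hB'' => h B'' (hB''.trans hB)

variable [TopologicalSpace X]

theorem Dominates.mono_left (h : Dominates c p A J B L) (hJ' : IsNormal J') (hA : A' ⊆ A)
    (hJ : J ⊆ J') : Dominates c p A' J' B L :=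
  fun B' hB' hB'L => hJ'.mono (fun _ => And.imp_left fun h => hA h) (hJ (h B' hB' hB'L))

variable [Finite κ]

variable (c) in
theorem exists_dominates (hJ : IsNormal J) (hL : IsNormal L) (hA : A ∉ J) (hB : B ∉ L) :
    ∃ A' ⊆ A, A' ∉ J ∧ ∃ B' ⊆ B, B' ∉ L ∧ ∃ p, Dominates c p A' J B' L := by
  classical
  have := Fintype.ofFinite κ
  by_contra! hno
  have key : ∀ F : Finset κ, ∃ A' ⊆ A, A' ∉ J ∧ ∃ B' ⊆ B, B' ∉ L ∧
      ∀ p ∈ F, ∀ ω ∈ A', colourNhd c ω.2 p ∩ B' ∈ L := by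
    intro F
    induction F using Finset.induction_on with
    | empty => exact ⟨A, subset_rfl, hA, B, subset_rfl, hB, by simp⟩
    | insert p F _ ih =>
      obtain ⟨A', hA', hA'J, B', hB', hB'L, h⟩ := ih
      have := hno A' hA' hA'J B' hB' hB'L p
      simp only [Dominates, not_forall] at this
      obtain ⟨B'', hB'', hB''L, hpos⟩ := this
      refine ⟨_, (sep_subset A' _).trans hA', hpos, B'', hB''.trans hB', hB''L, ?_⟩
      intro q hq ω hω
      rcases Finset.mem_insert.1 hq with rfl | hq
      · exact hω.2
      · exact hL.mono (inter_subset_inter_right _ hB'') (h q hq ω hω.1)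
  obtain ⟨A', -, hA'J, B', -, hB'L, h⟩ := key Finset.univ
  obtain ⟨ω, hω⟩ : A'.Nonempty := by
    rw [nonempty_iff_ne_empty]
    rintro rfl
    exact hA'J hJ.empty_mem
  refine hB'L (hL.mono ?_ (hL.iUnion_mem fun p => h p (Finset.mem_univ p) ω hω))
  exact fun ξ hξ => mem_iUnion.2 ⟨c s(ω.2, ξ.2), rfl, hξ⟩

variable (c) in
theorem exists_dominates_dominates (hJ : IsNormal J) (hL : IsNormal L) (hA : A ∉ J) (hB : B ∉ L) :
    ∃ A' ⊆ A, A' ∉ J ∧ ∃ B' ⊆ B, B' ∉ L ∧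
      ∃ p i, Dominates c p A' J B' L ∧ Dominates c i B' L A' J := by
  obtain ⟨A', hA', hA'J, B', hB', hB'L, p, hp⟩ := exists_dominates c hJ hL hA hB
  obtain ⟨B'', hB'', hB''L, A'', hA'', hA''J, i, hi⟩ := exists_dominates c hL hJ hB'L hA'J
  exact ⟨A'', hA''.trans hA', hA''J, B'', hB''.trans hB', hB''L, p, i,
    (hp.mono_left hJ hA'' subset_rfl).mono_right hB'', hi⟩

variable (c) in
/-- Every member of `R` dominates the positive set `A` of the ideal `J`. -/
def Fulfils (R : Set (Set (Set X × X) × Set (Set (Set X × X)) × κ)) (A : Set (Set X × X))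
    (J : Set (Set (Set X × X))) : Prop :=
  ∀ o ∈ R, Dominates c o.2.2 o.1 o.2.1 A J

end Domination

/-! ### The tower of ideals of a node -/

section Tower

variable {X : Type u}

/-- The sets covered by diagonal unions of members of `𝒮`. -/
def diagGenerate (𝒮 : Set (Set (Set X × X))) : Set (Set (Set X × X)) :=
  {Z | ∃ E : Term X → Set (Set X × X), (∀ t, E t ∈ 𝒮) ∧ Z ⊆ diag E}

theorem subset_diagGenerate (𝒮 : Set (Set (Set X × X))) : 𝒮 ⊆ diagGenerate 𝒮 :=
  fun Z hZ => ⟨fun _ => Z, fun _ => hZ, fun _ hω => ⟨.nat 0, trivial, hω⟩⟩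

theorem IsNormal.diagGenerate [TopologicalSpace X] {J 𝒮 : Set (Set (Set X × X))} (hJ : IsNormal J)
    (h : J ⊆ 𝒮) : IsNormal (diagGenerate 𝒮) where
  mono := fun hAB ⟨E, hE, hB⟩ => ⟨E, hE, hAB.trans hB⟩
  diag_mem Z hZ := by
    choose E hE hZE using hZ
    let E' : Term X → Set (Set X × X)
      | .pair s t => E s t
      | _ => ∅
    refine ⟨E', ?_, ?_⟩
    · rintro (n | x | ⟨s, t⟩)
      exacts [h hJ.empty_mem, h hJ.empty_mem, hE s t]
    · rintro ω ⟨s, hs, hω⟩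
      obtain ⟨t, ht, hωt⟩ := hZE s hω
      exact ⟨.pair s t, ⟨hs, ht⟩, hωt⟩
  fine z := subset_diagGenerate 𝒮 (h (hJ.fine z))
  limit := subset_diagGenerate 𝒮 (h hJ.limit)

/-- A set of pairs with an ideal, a family of requirements, and a target set from which the next
piece is to be taken. -/
structure Node (X : Type u) (κ : Type) : Type u where
  carrier : Set (Set X × X)
  ideal : Set (Set (Set X × X))
  reqs : Set (Set (Set X × X) × Set (Set (Set X × X)) × κ)
  target : Set (Set X × X)

variable {κ : Type} (c : Sym2 X → κ)

/-- The requirement `o` of `ν` fails at `A` for the ideal `J`. -/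
def Node.IsViolation (ν : Node X κ) (J : Set (Set (Set X × X))) (A : Set (Set X × X))
    (o : Set (Set X × X) × Set (Set (Set X × X)) × κ) : Prop :=
  o ∈ ν.reqs ∧ {q ∈ o.1 | colourNhd c q.2 o.2.2 ∩ A ∈ J} ∉ o.2.1

/-- A piece of the target of `ν` which, with the given colours, dominates and is dominated by `A`
for the ideal `J`. -/
def Node.IsPiece (ν : Node X κ) (J : Set (Set (Set X × X))) (A : Set (Set X × X))
    (d : Set (Set X × X) × κ × κ) : Prop :=
  d.1 ⊆ ν.target ∧ d.1 ∉ ν.ideal ∧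
    Dominates c d.2.1 A J d.1 ν.ideal ∧ Dominates c d.2.2 d.1 ν.ideal A J

/-- The sets added to the ideal `J` in one step of the tower of `ν`. -/
def Node.step (ν : Node X κ) (J : Set (Set (Set X × X))) : Set (Set (Set X × X)) :=
  {A | A ⊆ ν.carrier ∧ A ∉ J ∧
    ((¬ Fulfils c ν.reqs ν.carrier J ∧ ∃ o, ν.IsViolation c J A o) ∨
      (Fulfils c ν.reqs ν.carrier J ∧ ∃ d, ν.IsPiece c J A d))}

/-- The increasing tower of ideals of a node. -/
def Node.tower (ν : Node X κ) (α : Ordinal.{u}) : Set (Set (Set X × X)) :=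
  diagGenerate (ν.ideal ∪ {Z | ∃ β, ∃ _ : β < α, Z ∈ ν.step c (ν.tower β)})
termination_by α

theorem Node.tower_eq (ν : Node X κ) (α : Ordinal.{u}) : ν.tower c α =
    diagGenerate (ν.ideal ∪ {Z | ∃ β < α, Z ∈ ν.step c (ν.tower c β)}) := by
  rw [Node.tower]
  simp only [exists_prop]

theorem Node.ideal_subset_tower (ν : Node X κ) (α : Ordinal.{u}) : ν.ideal ⊆ ν.tower c α := by
  rw [ν.tower_eq]
  exact subset_union_left.trans (subset_diagGenerate _)

theorem Node.step_subset_tower (ν : Node X κ) {α β : Ordinal.{u}} (h : β < α) :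
    ν.step c (ν.tower c β) ⊆ ν.tower c α := by
  rw [ν.tower_eq c α]
  exact Subset.trans (fun Z hZ => Or.inr ⟨β, h, hZ⟩) (subset_diagGenerate _)

variable [TopologicalSpace X]

theorem Node.isNormal_tower {ν : Node X κ} (hν : IsNormal ν.ideal) (α : Ordinal.{u}) :
    IsNormal (ν.tower c α) := by
  rw [ν.tower_eq]
  exact hν.diagGenerate subset_union_left

/-- The tower of a node with positive target eventually swallows its carrier. -/
theorem Node.exists_carrier_mem_tower [Finite κ] {ν : Node X κ} (hν : IsNormal ν.ideal)
    (hP : ν.target ∉ ν.ideal) : ∃ α, ν.carrier ∈ ν.tower c α := by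
  by_contra! h
  have hstep : ∀ α, ∃ Z, Z ∈ ν.step c (ν.tower c α) := fun α => by
    by_cases hF : Fulfils c ν.reqs ν.carrier (ν.tower c α)
    · obtain ⟨A, hA, hAJ, B, hB, hBJ, p, i, hp, hi⟩ :=
        exists_dominates_dominates c (Node.isNormal_tower c hν α) hν (h α) hP
      exact ⟨A, hA, hAJ, Or.inr ⟨hF, (B, p, i), hB, hBJ, hp, hi⟩⟩
    · have hF' := hF
      simp only [Fulfils, Dominates, not_forall] at hF'
      obtain ⟨o, ho, A, hA, hAJ, hAo⟩ := hF'
      exact ⟨A, hA, hAJ, Or.inl ⟨hF, o, ho, hAo⟩⟩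
  choose S hS using hstep
  refine not_injective_of_ordinal S fun α β hαβ => ?_
  by_contra hne
  rcases lt_or_gt_of_ne hne with hlt | hlt
  · exact (hS β).2.1 (hαβ ▸ ν.step_subset_tower c hlt (hS α))
  · exact (hS α).2.1 (hαβ ▸ ν.step_subset_tower c hlt (hS β))

end Tower

/-! ### Generic pairs and the descent from a node to a child -/

section Descent

variable {X : Type u} {κ : Type} (c : Sym2 X → κ) (bas : X → ℕ → Set X)

open Classical in
/-- If `Z` lies in the tower of `ν`, a family which puts it there as early as possible. -/
noncomputable def Node.witness (ν : Node X κ) (Z : Set (Set X × X)) : Term X → Set (Set X × X) :=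
  if h : Z ∈ ν.tower c (sInf {α | Z ∈ ν.tower c α}) then
    ((ν.tower_eq c _).le h : Z ∈ diagGenerate _).choose
  else fun _ => ∅

theorem Node.witness_spec {ν : Node X κ} {Z : Set (Set X × X)} {α : Ordinal.{u}}
    (hZ : Z ∈ ν.tower c α) :
    (∀ t, ν.witness c Z t ∈ ν.ideal ∨ ∃ β < α, ν.witness c Z t ∈ ν.step c (ν.tower c β)) ∧
      Z ⊆ diag (ν.witness c Z) := by
  have h : Z ∈ ν.tower c (sInf {α | Z ∈ ν.tower c α}) :=
    csInf_mem (s := {α | Z ∈ ν.tower c α}) ⟨α, hZ⟩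
  have hle : sInf {α | Z ∈ ν.tower c α} ≤ α := csInf_le' hZ
  have hw : ν.witness c Z = ((ν.tower_eq c _).le h : Z ∈ diagGenerate _).choose := dif_pos h
  have hs := ((ν.tower_eq c _).le h : Z ∈ diagGenerate _).choose_spec
  rw [← hw] at hs
  exact ⟨fun t => (hs.1 t).imp_right fun ⟨β, hβ, h⟩ => ⟨β, hβ.trans_le hle, h⟩, hs.2⟩

/-- The earliest stage of the tower of `ν` at which the set `Z` is added. -/
noncomputable def Node.stage (ν : Node X κ) (Z : Set (Set X × X)) : Ordinal.{u} :=
  sInf {β | Z ∈ ν.step c (ν.tower c β)}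

theorem Node.mem_step_stage {ν : Node X κ} {Z : Set (Set X × X)} {β : Ordinal.{u}}
    (h : Z ∈ ν.step c (ν.tower c β)) :
    Z ∈ ν.step c (ν.tower c (ν.stage c Z)) ∧ ν.stage c Z ≤ β :=
  ⟨csInf_mem (s := {β | Z ∈ ν.step c (ν.tower c β)}) ⟨β, h⟩, csInf_le' h⟩

/-- The ideal attached to the set `Z` by the tower of `ν`. -/
noncomputable def Node.stageIdeal (ν : Node X κ) (Z : Set (Set X × X)) : Set (Set (Set X × X)) :=
  ν.tower c (ν.stage c Z)

variable [Nonempty κ]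

/-- A requirement of `ν` violated at `Z`, if there is one. -/
noncomputable def Node.violation (ν : Node X κ) (Z : Set (Set X × X)) :
    Set (Set X × X) × Set (Set (Set X × X)) × κ :=
  Classical.epsilon (ν.IsViolation c (ν.stageIdeal c Z) Z)

/-- A piece of the target of `ν` associated with `Z`, if there is one. -/
noncomputable def Node.piece (ν : Node X κ) (Z : Set (Set X × X)) : Set (Set X × X) × κ × κ :=
  Classical.epsilon (ν.IsPiece c (ν.stageIdeal c Z) Z)

/-- The node obtained from `ν` by passing to `Z`. -/
noncomputable def Node.child (ν : Node X κ) (Z : Set (Set X × X)) : Node X κ where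
  carrier := Z
  ideal := ν.stageIdeal c Z
  reqs := insert ((ν.piece c Z).1, ν.ideal, (ν.piece c Z).2.2) ν.reqs
  target := ∅

/-- The points of the carrier of `ν` not joined by the right colour to any point at which the
requirement violated at `Z` fails. -/
noncomputable def Node.unjoined (ν : Node X κ) (Z : Set (Set X × X)) : Set (Set X × X) :=
  {ω ∈ ν.carrier | ∀ z ∈ ω.1, (∃ q ∈ (ν.violation c Z).1,
    colourNhd c q.2 (ν.violation c Z).2.2 ∩ Z ∈ ν.stageIdeal c Z ∧ q.2 = z) →
      c s(z, ω.2) ≠ (ν.violation c Z).2.2}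

/-- The points of `Z` joined to few points of the associated piece. -/
noncomputable def Node.undominated (ν : Node X κ) (Z : Set (Set X × X)) : Set (Set X × X) :=
  {ω ∈ Z | colourNhd c ω.2 (ν.piece c Z).2.1 ∩ (ν.piece c Z).1 ∈ ν.ideal}

/-- The basic open set coded by a term. -/
def decodeOpen : Term X → Set X
  | .pair (.pt y) (.nat n) => bas y n
  | _ => ∅

/-- The colour neighbourhood of the point coded by a term, for the colour of the violation. -/
def decodeColourNhd (p : κ) : Term X → Set (Set X × X)
  | .pt z => colourNhd c z p
  | _ => ∅

/-- A node, a set of pairs and a term. -/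
structure Datum (X : Type u) (κ : Type) : Type u where
  node : Node X κ
  set : Set (Set X × X)
  term : Term X

/-- The operations on data under which the traces of pairs `(a, x)` are closed. -/
noncomputable def Datum.op (k : ℕ) (d e : Datum X κ) : Datum X κ :=
  match k with
  | 0 => ⟨d.node, d.node.witness c d.set e.term, d.term⟩
  | 1 => ⟨d.node, e.set, d.term⟩
  | 2 => ⟨d.node.child c d.set, d.set, d.term⟩
  | 3 => ⟨{ d.node with target := d.node.carrier ∩ {ω | ω.2 ∈ decodeOpen bas e.term} },
      d.node.carrier ∩ {ω | ω.2 ∈ decodeOpen bas e.term}, d.term⟩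
  | 4 => ⟨d.node, d.node.unjoined c d.set, d.term⟩
  | 5 => ⟨d.node, decodeColourNhd c (d.node.violation c d.set).2.2 e.term ∩ d.set, d.term⟩
  | 6 => ⟨d.node, d.node.undominated c d.set, d.term⟩
  | _ => ⟨d.node, d.node.carrier, d.term⟩

/-- The datum coded by a term over a sequence of initial data. -/
noncomputable def Datum.decode (con : ℕ → Datum X κ) : Term X → Datum X κ
  | .nat n => con n
  | .pair (.nat 0) t => { con 0 with term := t }
  | .pair (.nat (k + 1)) (.pair s t) => Datum.op c bas k (Datum.decode con s) (Datum.decode con t)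
  | _ => con 0

/-- The data coded by terms over `a`. -/
def Datum.trace (con : ℕ → Datum X κ) (a : Set X) : Set (Datum X κ) :=
  {d | ∃ t : Term X, t.Over a ∧ Datum.decode c bas con t = d}

variable {c bas} {con : ℕ → Datum X κ} {a : Set X}

theorem Datum.con_mem_trace (n : ℕ) : con n ∈ Datum.trace c bas con a := ⟨.nat n, trivial, rfl⟩

theorem Datum.exists_term_mem_trace {t : Term X} (ht : t.Over a) :
    ∃ d ∈ Datum.trace c bas con a, d.term = t :=
  ⟨_, ⟨.pair (.nat 0) t, ⟨trivial, ht⟩, rfl⟩, by rw [Datum.decode]⟩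

theorem Datum.op_mem_trace (k : ℕ) {d e : Datum X κ} (hd : d ∈ Datum.trace c bas con a)
    (he : e ∈ Datum.trace c bas con a) : Datum.op c bas k d e ∈ Datum.trace c bas con a := by
  obtain ⟨s, hs, rfl⟩ := hd
  obtain ⟨t, ht, rfl⟩ := he
  exact ⟨.pair (.nat (k + 1)) (.pair s t), ⟨trivial, hs, ht⟩, by rw [Datum.decode]⟩

variable [TopologicalSpace X]

variable (c bas con) in
/-- The node `ν` belongs to the trace of `ω`, has `ω` as a generic point, has a normal ideal and
satisfies its requirements, which concern downward closed families. -/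
structure Node.IsGood (ν : Node X κ) (ω : Set X × X) : Prop where
  mem_trace : ∃ d ∈ Datum.trace c bas con ω.1, d.node = ν
  normal : IsNormal ν.ideal
  mem_carrier : ω ∈ ν.carrier
  generic : ∀ d ∈ Datum.trace c bas con ω.1, d.set ∈ ν.ideal → ω ∉ d.set
  fulfils : Fulfils c ν.reqs ν.carrier ν.ideal
  reqs_mono : ∀ o ∈ ν.reqs, ∀ A B : Set (Set X × X), A ⊆ B → B ∈ o.2.1 → A ∈ o.2.1

/-- The descent from a node to a child: the new piece lies in a prescribed basic open
neighbourhood, and its colours with the child are controlled. -/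
theorem Node.IsGood.exists_child [Finite κ] {ν : Node X κ} {ω : Set X × X}
    (h : ν.IsGood c bas con ω) {y : X} (hy : y ∈ ω.1) {n : ℕ} (hω : ω.2 ∈ bas y n) :
    ∃ (ν' : Node X κ) (B : Set (Set X × X)) (p i : κ), ν'.IsGood c bas con ω ∧
      ν'.carrier ⊆ ν.carrier ∧ ν.ideal ⊆ ν'.ideal ∧ ν.reqs ⊆ ν'.reqs ∧
      (B, ν.ideal, i) ∈ ν'.reqs ∧ B ⊆ ν.carrier ∧ (∀ ξ ∈ B, ξ.2 ∈ bas y n) ∧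
      colourNhd c ω.2 p ∩ B ∉ ν.ideal ∧
      Dominates c p ν'.carrier ν'.ideal B ν.ideal := by
  classical
  obtain ⟨d, hd, hdν⟩ := h.mem_trace
  -- restrict the target of the node to the given open set
  obtain ⟨e, he, het⟩ := Datum.exists_term_mem_trace (c := c) (bas := bas) (con := con)
    (a := ω.1) (t := .pair (.pt y) (.nat n)) ⟨hy, trivial⟩
  set P : Set (Set X × X) := ν.carrier ∩ {ω | ω.2 ∈ bas y n} with hP
  let μ : Node X κ := { ν with target := P }
  have hμ : (⟨μ, P, d.term⟩ : Datum X κ) ∈ Datum.trace c bas con ω.1 := by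
    have := Datum.op_mem_trace 3 hd he
    simpa only [Datum.op, hdν, het, decodeOpen] using this
  have hPJ : P ∉ ν.ideal := fun hPJ => h.generic _ hμ hPJ ⟨h.mem_carrier, hω⟩
  have hμnode : ∀ {Z : Set (Set X × X)}, (∃ e ∈ Datum.trace c bas con ω.1, e.set = Z) →
      (⟨μ, Z, d.term⟩ : Datum X κ) ∈ Datum.trace c bas con ω.1 := by
    rintro Z ⟨e, he, rfl⟩
    exact Datum.op_mem_trace 1 hμ he
  -- the least stage of the tower containing a set of the trace through `ω`
  let S : Set Ordinal.{u} :=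
    {α | ∃ e ∈ Datum.trace c bas con ω.1, e.set ∈ μ.tower c α ∧ ω ∈ e.set}
  have hS : S.Nonempty := by
    obtain ⟨α, hα⟩ := Node.exists_carrier_mem_tower c (ν := μ) h.normal hPJ
    exact ⟨α, _, Datum.op_mem_trace 7 hμ hμ, hα, h.mem_carrier⟩
  obtain ⟨e, he, heα, hωe⟩ := csInf_mem hS
  have hgen : ∀ β < sInf S, ∀ e ∈ Datum.trace c bas con ω.1, e.set ∈ μ.tower c β → ω ∉ e.set :=
    fun β hβ e he heβ hωe => not_le.2 hβ (csInf_le' ⟨e, he, heβ, hωe⟩)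
  obtain ⟨hE, hsub⟩ := Node.witness_spec c heα
  obtain ⟨t, ht, hωt⟩ := hsub hωe
  set A := μ.witness c e.set t with hA
  have hAtr : (⟨μ, A, d.term⟩ : Datum X κ) ∈ Datum.trace c bas con ω.1 := by
    obtain ⟨e', he', rfl⟩ := Datum.exists_term_mem_trace (c := c) (bas := bas) (con := con) ht
    exact Datum.op_mem_trace 0 (hμnode ⟨e, he, rfl⟩) he'
  obtain ⟨β, hβ, hAβ⟩ : ∃ β < sInf S, A ∈ μ.step c (μ.tower c β) :=
    (hE t).resolve_left fun hAJ => h.generic _ hAtr hAJ hωt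
  obtain ⟨hAs, hstage⟩ := Node.mem_step_stage c hAβ
  have hgen' := hgen _ (hstage.trans_lt hβ)
  obtain ⟨hAν, -, hcase⟩ := hAs
  have hnormal : IsNormal (μ.stageIdeal c A) := Node.isNormal_tower c (ν := μ) h.normal _
  rcases hcase with ⟨-, hviol⟩ | ⟨hful, hpiece⟩
  · -- a violated requirement contradicts genericity
    exfalso
    obtain ⟨ho, hQ⟩ := Classical.epsilon_spec hviol
    change μ.violation c A ∈ ν.reqs at ho
    change {q ∈ (μ.violation c A).1 | colourNhd c q.2 (μ.violation c A).2.2 ∩ A ∈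
      μ.stageIdeal c A} ∉ (μ.violation c A).2.1 at hQ
    have hZ : μ.unjoined c A ∈ ν.ideal := by
      by_contra hZ
      have hdom := h.fulfils _ ho (μ.unjoined c A) (fun _ h => h.1) hZ
      refine hQ (h.reqs_mono _ ho _ _ ?_ hdom)
      rintro q ⟨hq, hqA⟩
      refine ⟨hq, h.normal.mono ?_ (h.normal.fine q.2)⟩
      rintro ξ ⟨hξ, -, hξZ⟩ hqξ
      exact hξZ q.2 hqξ ⟨q, hq, hqA, rfl⟩ hξ
    have hωZ := h.generic _ (Datum.op_mem_trace 4 hAtr hAtr) hZ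
    have : ∃ z ∈ ω.1, (∃ q ∈ (μ.violation c A).1, colourNhd c q.2 (μ.violation c A).2.2 ∩ A ∈
        μ.stageIdeal c A ∧ q.2 = z) ∧ c s(z, ω.2) = (μ.violation c A).2.2 := by
      by_contra! hcon
      exact hωZ ⟨h.mem_carrier, hcon⟩
    obtain ⟨z, hz, ⟨q, -, hqA, rfl⟩, hzω⟩ := this
    obtain ⟨e', he', het'⟩ := Datum.exists_term_mem_trace (c := c) (bas := bas) (con := con)
      (a := ω.1) (t := .pt q.2) hz
    have h5 := Datum.op_mem_trace 5 hAtr he'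
    simp only [Datum.op, het', decodeColourNhd] at h5
    exact hgen' _ h5 hqA ⟨hzω, hωt⟩
  · obtain ⟨hB, hBJ, hp, hi⟩ := Classical.epsilon_spec hpiece
    change (μ.piece c A).1 ⊆ P at hB
    refine ⟨μ.child c A, (μ.piece c A).1, (μ.piece c A).2.1, (μ.piece c A).2.2, ⟨?_, hnormal, hωt,
      hgen', ?_, ?_⟩, hAν, μ.ideal_subset_tower c _, subset_insert _ _, mem_insert _ _,
      fun ξ hξ => (hB hξ).1, fun ξ hξ => (hB hξ).2, ?_, hp⟩
    · exact ⟨_, Datum.op_mem_trace 2 hAtr hAtr, rfl⟩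
    · rintro o (rfl | ho)
      · exact hi
      · exact (hful o ho).mono_right hAν
    · rintro o (rfl | ho)
      · exact fun _ _ => h.normal.mono
      · exact h.reqs_mono o ho
    · intro hcon
      exact hgen' _ (Datum.op_mem_trace 6 hAtr hAtr) (hp _ subset_rfl hBJ) ⟨hωt, hcon⟩

end Descent

/-! ### Fans of pieces converging to a point -/

section Fan

variable {X : Type u} [TopologicalSpace X] {κ : Type} [Finite κ] [Nonempty κ] (c : Sym2 X → κ)
  {bas : X → ℕ → Set X}

/-- In a positive set with fulfilled requirements there is a pair `ω`, avoiding a given null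
set, and a sequence of positive pieces of the set converging to the second coordinate
of `ω`, such that the pieces dominate each other in both directions with two fixed colours. -/
theorem exists_fan [FirstCountableTopology X]
    (hbas : ∀ x U, IsOpen U → x ∈ U → ∃ V, IsOpen V ∧ x ∈ V ∧ V ⊆ U ∧
      ∀ y ∈ V, ∃ n, bas y n = V)
    {J : Set (Set (Set X × X))} (hJ : IsNormal J) {A : Set (Set X × X)} (hA : A ∉ J)
    {R : Set (Set (Set X × X) × Set (Set (Set X × X)) × κ)} (hR : Fulfils c R A J)
    (hRmono : ∀ o ∈ R, ∀ A B : Set (Set X × X), A ⊆ B → B ∈ o.2.1 → A ∈ o.2.1)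
    {Z : Set (Set X × X)} (hZ : Z ∈ J) :
    ∃ ω ∈ A, ω ∉ Z ∧ ∃ (p i : κ) (B : ℕ → Set (Set X × X))
      (L : ℕ → Set (Set (Set X × X))) (V : ℕ → Set X),
      (∀ U ∈ 𝓝 ω.2, ∃ N, ∀ r ≥ N, V r ⊆ U) ∧
      (∀ r, B r ⊆ A ∧ IsNormal (L r) ∧ J ⊆ L r ∧ colourNhd c ω.2 p ∩ B r ∉ L r ∧
        (∀ ξ ∈ B r, ξ.2 ∈ V r) ∧ Fulfils c R (B r) (L r)) ∧
      ∀ r s, r < s → Dominates c p (B s) (L s) (B r) (L r) ∧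
        Dominates c i (B r) (L r) (B s) (L s) := by
  classical
  let root : Node X κ := ⟨A, J, R, ∅⟩
  let con : ℕ → Datum X κ :=
    fun _ => ⟨root, {ω : Set X × X | ¬(ω.2 ∈ closure ω.1 ∧ ω.2 ∉ ω.1)} ∪ Z, .nat 0⟩
  obtain ⟨ω, hω, hgen⟩ := hJ.exists_generic hA fun t => (Datum.decode c bas con t).set
  have hgen' : ∀ d ∈ Datum.trace c bas con ω.1, d.set ∈ J → ω ∉ d.set := by
    rintro _ ⟨t, ht, rfl⟩
    exact hgen t ht
  have hroot : root.IsGood c bas con ω :=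
    ⟨⟨_, Datum.con_mem_trace 0, rfl⟩, hJ, hω, hgen', hR, hRmono⟩
  have hav := hgen' _ (Datum.con_mem_trace 0) (hJ.union_mem hJ.limit hZ)
  have hcl : ω.2 ∈ closure ω.1 := (not_not.1 fun h => hav (Or.inl h)).1
  obtain ⟨O, hO⟩ := (𝓝 ω.2).exists_antitone_basis
  have hV : ∀ r, ∃ V, ω.2 ∈ V ∧ V ⊆ O r ∧ ∃ y ∈ ω.1, ∃ n, bas y n = V := fun r => by
    obtain ⟨U, hUO, hUo, hωU⟩ := mem_nhds_iff.1 (hO.mem r)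
    obtain ⟨V, hVo, hωV, hVU, hVbas⟩ := hbas _ U hUo hωU
    obtain ⟨y, hyV, hy⟩ := mem_closure_iff.1 hcl V hVo hωV
    exact ⟨V, hωV, hVU.trans hUO, y, hy, hVbas y hyV⟩
  choose V hωV hVO y hy n hn using hV
  choose next B p i hgood hcar hideal hreqs hmem hBsub hBV hpos hdom using
    fun (r : ℕ) (ν : {ν : Node X κ // ν.IsGood c bas con ω}) =>
      ν.2.exists_child (hy r) (n := n r) ((hn r).symm ▸ hωV r)
  let ν : ℕ → {ν : Node X κ // ν.IsGood c bas con ω} :=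
    fun r => Nat.rec ⟨root, hroot⟩ (fun r ν => ⟨next r ν, hgood r ν⟩) r
  have hcar' : Antitone fun r => (ν r).1.carrier :=
    antitone_nat_of_succ_le fun r => hcar r (ν r)
  have hideal' : Monotone fun r => (ν r).1.ideal :=
    monotone_nat_of_le_succ fun r => hideal r (ν r)
  have hreqs' : Monotone fun r => (ν r).1.reqs :=
    monotone_nat_of_le_succ fun r => hreqs r (ν r)
  obtain ⟨⟨p₀, i₀⟩, hinf⟩ := Finite.exists_infinite_fiber fun r => (p r (ν r), i r (ν r))
  let e := Nat.orderEmbeddingOfSet ((fun r => (p r (ν r), i r (ν r))) ⁻¹' {(p₀, i₀)})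
  have he : ∀ r, p (e r) (ν (e r)) = p₀ ∧ i (e r) (ν (e r)) = i₀ := fun r => by
    have : e r ∈ (fun r => (p r (ν r), i r (ν r))) ⁻¹' {(p₀, i₀)} := by
      rw [← Nat.orderEmbeddingOfSet_range ((fun r => (p r (ν r), i r (ν r))) ⁻¹' {(p₀, i₀)})]
      exact mem_range_self r
    exact Prod.mk.injEq _ _ _ _ ▸ this
  refine ⟨ω, hω, fun h => hav (Or.inr h), p₀, i₀, fun r => B (e r) (ν (e r)),
    fun r => (ν (e r)).1.ideal, fun r => V (e r), fun U hU => ?_, fun r => ⟨?_, ?_, ?_, ?_, ?_, ?_⟩,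
    fun r s hrs => ?_⟩
  · obtain ⟨N, hN⟩ := hO.mem_iff.1 hU
    exact ⟨N, fun r hr => (hVO _).trans
      ((hO.antitone (hr.trans (e.strictMono.le_apply))).trans hN)⟩
  · exact (hBsub _ _).trans (hcar' (Nat.zero_le _))
  · exact (ν _).2.normal
  · exact hideal' (Nat.zero_le _)
  · rw [← (he r).1]
    exact hpos _ _
  · exact fun ξ hξ => (hn (e r)).le (hBV _ _ ξ hξ)
  · exact fun o ho => ((ν (e r)).2.fulfils o (hreqs' (Nat.zero_le _) ho)).mono_right (hBsub _ _)
  · have hlt : e r + 1 ≤ e s := e.strictMono hrs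
    constructor
    · rw [← (he r).1]
      exact (hdom (e r) (ν (e r))).mono_left (ν (e s)).2.normal
        ((hBsub _ _).trans (hcar' hlt)) (hideal' hlt)
    · rw [← (he r).2]
      exact ((ν (e s)).2.fulfils _ (hreqs' hlt (hmem (e r) (ν (e r))))).mono_right (hBsub _ _)

end Fan

/-! ### The tree of points -/

section Tree

theorem encode_lt_encode_of_cons_suffix {a : ℕ} {m s : List ℕ} (h : a :: m <:+ s) :
    Encodable.encode m < Encodable.encode s := by
  induction s with
  | nil => simp at h
  | cons b t ih =>
    have hlt : Encodable.encode t < Encodable.encode (b :: t) := by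
      rw [Encodable.encode_list_cons]
      exact Nat.lt_succ_of_le (Nat.right_le_pair _ _)
    rcases List.suffix_cons_iff.1 h with h | h
    · obtain ⟨rfl, rfl⟩ := List.cons.inj h
      exact hlt
    · exact (ih h).trans hlt

theorem eq_of_cons_suffix_of_cons_suffix {a b : ℕ} {m s : List ℕ} (ha : a :: m <:+ s)
    (hb : b :: m <:+ s) : a = b :=
  (List.cons.inj ((List.suffix_of_suffix_length_le ha hb (by simp)).eq_of_length (by simp))).1

/-- At stage `n` the nodes with code below `n` have been treated; `s` is active if it is untreated
but its parent is treated. -/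
def IsActive (n : ℕ) (s : List ℕ) : Prop :=
  n ≤ Encodable.encode s ∧ ∀ a t, s = a :: t → Encodable.encode t < n

theorem IsActive.encode_lt {n a : ℕ} {s m : List ℕ} (hs : IsActive n s) (h : a :: m <:+ s) :
    Encodable.encode m < n := by
  rcases s with _ | ⟨b, t⟩
  · simp at h
  · rcases List.suffix_cons_iff.1 h with h | h
    · exact hs.2 a m h.symm
    · exact (encode_lt_encode_of_cons_suffix h).trans (hs.2 b t rfl)

theorem isActive_encode (u : List ℕ) : IsActive (Encodable.encode u) u :=
  ⟨le_rfl, fun a _ h => encode_lt_encode_of_cons_suffix (a := a) (h ▸ List.suffix_rfl)⟩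

theorem IsActive.of_succ {u s : List ℕ} (hs : IsActive (Encodable.encode u + 1) s) :
    (∃ r, s = r :: u) ∨ (IsActive (Encodable.encode u) s ∧ s ≠ u ∧ ∀ r, s ≠ r :: u) := by
  by_cases h : ∃ r, s = r :: u
  · exact Or.inl h
  · push Not at h
    refine Or.inr ⟨⟨by have := hs.1; omega, fun a t hat => ?_⟩, ?_, h⟩
    · have h1 := hs.2 a t hat
      have h2 : Encodable.encode t ≠ Encodable.encode u := fun he =>
        h a (Encodable.encode_injective he ▸ hat)
      omega
    · rintro rfl
      have := hs.1
      omega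

variable {X : Type u} {κ : Type}

/-- The data attached to a treated node: a point, two colours, and a sequence of neighbourhoods. -/
structure Mark (X : Type u) (κ : Type) : Type u where
  point : X
  down : κ
  across : κ
  nhd : ℕ → Set X

/-- If the nodes `s` and `t` branch at `m` then `k` is one of the colours attached to `m`. -/
def AllowedColour (h : List ℕ → Mark X κ) (s t : List ℕ) (k : κ) : Prop :=
  ∀ (m : List ℕ) (a b : ℕ), a ≠ b → a :: m <:+ s → b :: m <:+ t →
    k = (h m).down ∨ k = (h m).across

/-- The point `x`, seen as lying at the node `s`, is related as it should to the point at `m`. -/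
def IsLocated (c : Sym2 X → κ) (h : List ℕ → Mark X κ) (m s : List ℕ) (x : X) : Prop :=
  (∀ r, r :: m <:+ s → c s((h m).point, x) = (h m).down ∧ x ∈ (h m).nhd r) ∧
    AllowedColour h m s (c s((h m).point, x))

theorem AllowedColour.congr_left {h h' : List ℕ → Mark X κ} {s t : List ℕ} {k : κ}
    (H : AllowedColour h s t k) (hh : ∀ a m, a :: m <:+ s → h' m = h m) :
    AllowedColour h' s t k := fun m a b hab has hbt => by
  rw [hh a m has]
  exact H m a b hab has hbt

theorem IsLocated.congr {c : Sym2 X → κ} {h h' : List ℕ → Mark X κ} {m s : List ℕ} {x : X}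
    (H : IsLocated c h m s x) (hh : ∀ w, Encodable.encode w ≤ Encodable.encode m → h' w = h w) :
    IsLocated c h' m s x := by
  rw [IsLocated, hh m le_rfl]
  exact ⟨H.1, H.2.congr_left fun a w haw => hh w (encode_lt_encode_of_cons_suffix haw).le⟩

variable [TopologicalSpace X] (c : Sym2 X → κ)

/-- A stage of the construction: a set and an ideal for each active node, and the data of the
treated nodes. -/
structure Stage (X : Type u) (κ : Type) : Type u where
  carrier : List ℕ → Set (Set X × X)
  ideal : List ℕ → Set (Set (Set X × X))
  mark : List ℕ → Mark X κ

/-- The invariants of the construction. -/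
structure Stage.IsValid (S : Stage X κ) (n : ℕ) : Prop where
  normal : ∀ s, IsActive n s → IsNormal (S.ideal s)
  positive : ∀ s, IsActive n s → S.carrier s ∉ S.ideal s
  dominates : ∀ s t, IsActive n s → IsActive n t → s ≠ t → ∃ k, AllowedColour S.mark s t k ∧
    Dominates c k (S.carrier s) (S.ideal s) (S.carrier t) (S.ideal t)
  located : ∀ m s, Encodable.encode m < n → IsActive n s → ∀ ω ∈ S.carrier s,
    IsLocated c S.mark m s ω.2
  nhd : ∀ m, Encodable.encode m < n → ∀ U ∈ 𝓝 (S.mark m).point,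
    ∃ N, ∀ r ≥ N, (S.mark m).nhd r ⊆ U
  pairs : ∀ m m', Encodable.encode m < Encodable.encode m' → Encodable.encode m' < n →
    IsLocated c S.mark m m' (S.mark m').point ∧ (S.mark m).point ≠ (S.mark m').point

variable [FirstCountableTopology X] [Finite κ] [Nonempty κ] {c} {bas : X → ℕ → Set X}

/-- The treatment of one more node. -/
theorem Stage.IsValid.exists_succ
    (hbas : ∀ x U, IsOpen U → x ∈ U → ∃ V, IsOpen V ∧ x ∈ V ∧ V ⊆ U ∧
      ∀ y ∈ V, ∃ n, bas y n = V)
    {S : Stage X κ} {u : List ℕ} (hS : S.IsValid c (Encodable.encode u)) :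
    ∃ S' : Stage X κ, S'.IsValid c (Encodable.encode u + 1) ∧
      ∀ m, Encodable.encode m < Encodable.encode u → S'.mark m = S.mark m := by
  classical
  have hu := isActive_encode u
  have hk : ∀ t, ∃ k, IsActive (Encodable.encode u) t → t ≠ u → AllowedColour S.mark u t k ∧
      Dominates c k (S.carrier u) (S.ideal u) (S.carrier t) (S.ideal t) := fun t => by
    by_cases h : IsActive (Encodable.encode u) t ∧ t ≠ u
    · obtain ⟨k, hk⟩ := hS.dominates u t hu h.1 h.2.symm
      exact ⟨k, fun _ _ => hk⟩
    · exact ⟨Classical.arbitrary κ, fun h₁ h₂ => absurd ⟨h₁, h₂⟩ h⟩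
  choose k hk using hk
  have hJ := hS.normal u hu
  let R : Set (Set (Set X × X) × Set (Set (Set X × X)) × κ) :=
    {o | ∃ t, IsActive (Encodable.encode u) t ∧ o.1 = S.carrier t ∧ o.2.1 = S.ideal t ∧
      Dominates c o.2.2 (S.carrier t) (S.ideal t) (S.carrier u) (S.ideal u)}
  have hR : Fulfils c R (S.carrier u) (S.ideal u) := by
    rintro ⟨Q, L, i⟩ ⟨t, -, rfl, rfl, h⟩
    exact h
  have hRmono : ∀ o ∈ R, ∀ A B : Set (Set X × X), A ⊆ B → B ∈ o.2.1 → A ∈ o.2.1 := by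
    rintro ⟨Q, L, i⟩ ⟨t, ht, rfl, rfl, -⟩ A B hAB hB
    exact (hS.normal t ht).mono hAB hB
  let Z₁ : List ℕ → Set (Set X × X) := fun t =>
    if IsActive (Encodable.encode u) t ∧ t ≠ u then
      {ω ∈ S.carrier u | colourNhd c ω.2 (k t) ∩ S.carrier t ∈ S.ideal t} else ∅
  let Z₂ : List ℕ → Set (Set X × X) := fun m => {ω | ω.2 = (S.mark m).point}
  have hZ₁ : ∀ t, Z₁ t ∈ S.ideal u := fun t => by
    by_cases h : IsActive (Encodable.encode u) t ∧ t ≠ u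
    · simp only [Z₁, if_pos h]
      exact (hk t h.1 h.2).2 _ subset_rfl (hS.positive t h.1)
    · simp only [Z₁, if_neg h]
      exact hJ.empty_mem
  have hZ₂ : ∀ m, Z₂ m ∈ S.ideal u := fun m => by
    refine hJ.mono ?_ (hJ.union_mem (hJ.fine (S.mark m).point) hJ.limit)
    intro ω hω
    by_cases h : (S.mark m).point ∈ ω.1
    · exact Or.inr fun h' => h'.2 (by rwa [show ω.2 = _ from hω])
    · exact Or.inl h
  obtain ⟨ω, hω, hωZ, p, i, B, L, V, hV, hB, hBB⟩ := exists_fan c hbas hJ (hS.positive u hu) hR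
    hRmono (hJ.union_mem (hJ.iUnion_mem hZ₁) (hJ.iUnion_mem hZ₂))
  have hω₁ : ∀ t, IsActive (Encodable.encode u) t → t ≠ u →
      colourNhd c ω.2 (k t) ∩ S.carrier t ∉ S.ideal t := fun t ht htu h =>
    hωZ (Or.inl (mem_iUnion.2 ⟨t, by simp only [Z₁, if_pos (And.intro ht htu)]; exact ⟨hω, h⟩⟩))
  have hω₂ : ∀ m, (S.mark m).point ≠ ω.2 := fun m h =>
    hωZ (Or.inr (mem_iUnion.2 ⟨m, h.symm⟩))
  let S' : Stage X κ :=
    { carrier := fun s => if s.tail = u then colourNhd c ω.2 p ∩ B (s.headD 0)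
        else colourNhd c ω.2 (k s) ∩ S.carrier s
      ideal := fun s => if s.tail = u then L (s.headD 0) else S.ideal s
      mark := Function.update S.mark u ⟨ω.2, p, i, V⟩ }
  have hmu : S'.mark u = ⟨ω.2, p, i, V⟩ := Function.update_self ..
  have hmo : ∀ m, Encodable.encode m < Encodable.encode u → S'.mark m = S.mark m := fun m hm =>
    Function.update_of_ne (by rintro rfl; exact lt_irrefl _ hm) ..
  have hcc : ∀ r, S'.carrier (r :: u) = colourNhd c ω.2 p ∩ B r := fun r => if_pos rfl
  have hic : ∀ r, S'.ideal (r :: u) = L r := fun r => if_pos rfl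
  have htail : ∀ s, s ≠ u → (∀ r, s ≠ r :: u) → s.tail ≠ u := by
    rintro (_ | ⟨r, t⟩) h₁ h₂ h
    · exact h₁ h
    · exact h₂ r (congrArg (r :: ·) h)
  have hco : ∀ s, s ≠ u → (∀ r, s ≠ r :: u) →
      S'.carrier s = colourNhd c ω.2 (k s) ∩ S.carrier s := fun s h₁ h₂ => if_neg (htail s h₁ h₂)
  have hio : ∀ s, s ≠ u → (∀ r, s ≠ r :: u) → S'.ideal s = S.ideal s :=
    fun s h₁ h₂ => if_neg (htail s h₁ h₂)
  -- a node branching off a child of `u` at `m ≠ u` branches off `u`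
  have hsuf : ∀ {a r : ℕ} {m : List ℕ}, m ≠ u → a :: m <:+ r :: u → a :: m <:+ u :=
    fun hm h => (List.suffix_cons_iff.1 h).resolve_left fun h => hm (List.cons.inj h).2
  have hno : ∀ {a : ℕ}, ¬ a :: u <:+ u := fun h => lt_irrefl _ (encode_lt_encode_of_cons_suffix h)
  have hallow : ∀ {s t : List ℕ} {q : κ}, IsActive (Encodable.encode u) s →
      AllowedColour S.mark s t q → AllowedColour S'.mark s t q := fun hs h =>
    h.congr_left fun a m ham => hmo m (hs.encode_lt ham)
  have hallow' : ∀ {t : List ℕ} {q : κ} {r : ℕ}, IsActive (Encodable.encode u) t →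
      AllowedColour S.mark u t q → AllowedColour S'.mark (r :: u) t q := by
    intro t q r ht h m a b hab has hbt
    have hm := ht.encode_lt hbt
    have hmu : m ≠ u := by rintro rfl; exact lt_irrefl _ hm
    rw [hmo m hm]
    exact h m a b hab (hsuf hmu has) hbt
  refine ⟨S', ⟨fun s hs => ?_, fun s hs => ?_, fun s t hs ht hst => ?_, fun m s hm hs ξ hξ => ?_,
    fun m hm => ?_, fun m m' hmm' hm' => ?_⟩, hmo⟩
  · rcases hs.of_succ with ⟨r, rfl⟩ | ⟨hs, hsu, hsr⟩
    · rw [hic]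
      exact (hB r).2.1
    · rw [hio s hsu hsr]
      exact hS.normal s hs
  · rcases hs.of_succ with ⟨r, rfl⟩ | ⟨hs, hsu, hsr⟩
    · rw [hic, hcc]
      exact (hB r).2.2.2.1
    · rw [hio s hsu hsr, hco s hsu hsr]
      exact hω₁ s hs hsu
  · rcases hs.of_succ with ⟨r, rfl⟩ | ⟨hs, hsu, hsr⟩ <;>
      rcases ht.of_succ with ⟨r', rfl⟩ | ⟨ht, htu, htr⟩
    · have hq : ∀ q, q = p ∨ q = i → AllowedColour S'.mark (r :: u) (r' :: u) q := by
        intro q hq m a b hab ha hb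
        by_cases hm : m = u
        · subst hm
          simpa only [hmu] using hq
        · exact absurd (eq_of_cons_suffix_of_cons_suffix (hsuf hm ha) (hsuf hm hb)) hab
      rw [hcc, hcc, hic, hic]
      rcases lt_trichotomy r r' with h | rfl | h
      · exact ⟨i, hq i (Or.inr rfl), (((hBB r r' h).2).mono_left (hB r).2.1 inter_subset_right
          subset_rfl).mono_right inter_subset_right⟩
      · exact absurd rfl hst
      · exact ⟨p, hq p (Or.inl rfl), (((hBB r' r h).1).mono_left (hB r).2.1 inter_subset_right
          subset_rfl).mono_right inter_subset_right⟩
    · rw [hcc, hic, hco t htu htr, hio t htu htr]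
      obtain ⟨h₁, h₂⟩ := hk t ht htu
      exact ⟨k t, hallow' ht h₁, (h₂.mono_left (hB r).2.1
        (inter_subset_right.trans (hB r).1) (hB r).2.2.1).mono_right inter_subset_right⟩
    · rw [hcc, hic, hco s hsu hsr, hio s hsu hsr]
      obtain ⟨q, h₁, h₂⟩ := hS.dominates s u hs hu hsu
      refine ⟨q, fun m a b hab has hbu => ?_, (((hB r').2.2.2.2.2 (_, _, q)
        ⟨s, hs, rfl, rfl, h₂⟩).mono_left (hS.normal s hs) inter_subset_right
        subset_rfl).mono_right inter_subset_right⟩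
      have hm := hs.encode_lt has
      rw [hmo m hm]
      exact h₁ m a b hab has (hsuf (by rintro rfl; exact lt_irrefl _ hm) hbu)
    · rw [hco s hsu hsr, hio s hsu hsr, hco t htu htr, hio t htu htr]
      obtain ⟨q, h₁, h₂⟩ := hS.dominates s t hs ht hst
      exact ⟨q, hallow hs h₁, (h₂.mono_left (hS.normal s hs) inter_subset_right
        subset_rfl).mono_right inter_subset_right⟩
  · by_cases hmu' : m = u
    · subst hmu'
      rcases hs.of_succ with ⟨r, rfl⟩ | ⟨hs, hsu, hsr⟩
      · rw [hcc] at hξ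
        rw [IsLocated, hmu]
        refine ⟨fun r' hr' => ?_, fun w a b hab ha hb => ?_⟩
        · obtain rfl : r' = r := eq_of_cons_suffix_of_cons_suffix hr' List.suffix_rfl
          exact ⟨hξ.1, (hB r').2.2.2.2.1 ξ hξ.2⟩
        · have hw : w ≠ m := by rintro rfl; exact hno ha
          exact absurd (eq_of_cons_suffix_of_cons_suffix ha (hsuf hw hb)) hab
      · rw [hco s hsu hsr] at hξ
        rw [IsLocated, hmu]
        refine ⟨fun r hr => absurd (hs.encode_lt hr) (lt_irrefl _), ?_⟩
        simp only
        rw [show c s(ω.2, ξ.2) = k s from hξ.1]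
        exact hallow hu (hk s hs hsu).1
    · have hm' : Encodable.encode m < Encodable.encode u :=
        lt_of_le_of_ne (Nat.lt_succ_iff.1 hm) fun h => hmu' (Encodable.encode_injective h)
      have hcongr : ∀ w, Encodable.encode w ≤ Encodable.encode m → S'.mark w = S.mark w :=
        fun w hw => hmo w (hw.trans_lt hm')
      rcases hs.of_succ with ⟨r, rfl⟩ | ⟨hs, hsu, hsr⟩
      · rw [hcc] at hξ
        have h := hS.located m u hm' hu ξ ((hB r).1 hξ.2)
        refine IsLocated.congr ⟨fun r' hr' => h.1 r' (hsuf hmu' hr'), fun w a b hab ha hb => ?_⟩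
          hcongr
        refine h.2 w a b hab ha (hsuf ?_ hb)
        rintro rfl
        exact lt_irrefl _ (hm'.trans (encode_lt_encode_of_cons_suffix ha))
      · rw [hco s hsu hsr] at hξ
        exact (hS.located m s hm' hs ξ hξ.2).congr hcongr
  · by_cases hmu' : m = u
    · subst hmu'
      rw [hmu]
      exact hV
    · have hm' : Encodable.encode m < Encodable.encode u :=
        lt_of_le_of_ne (Nat.lt_succ_iff.1 hm) fun h => hmu' (Encodable.encode_injective h)
      rw [hmo m hm']
      exact hS.nhd m hm'
  · have hm : Encodable.encode m < Encodable.encode u :=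
      hmm'.trans_le (Nat.lt_succ_iff.1 hm')
    have hcongr : ∀ w, Encodable.encode w ≤ Encodable.encode m → S'.mark w = S.mark w :=
      fun w hw => hmo w (hw.trans_lt hm)
    by_cases hmu' : m' = u
    · subst hmu'
      rw [hmu, hmo m hm]
      exact ⟨(hS.located m m' hm hu ω hω).congr hcongr, hω₂ m⟩
    · have hm'' : Encodable.encode m' < Encodable.encode u :=
        lt_of_le_of_ne (Nat.lt_succ_iff.1 hm') fun h => hmu' (Encodable.encode_injective h)
      rw [hmo m hm, hmo m' hm'']
      exact ⟨(hS.pairs m m' hmm' hm'').1.congr hcongr, (hS.pairs m m' hmm' hm'').2⟩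

theorem exists_tree [T1Space X] (hX : ¬ LeftSeparated X)
    (hbas : ∀ x U, IsOpen U → x ∈ U → ∃ V, IsOpen V ∧ x ∈ V ∧ V ⊆ U ∧
      ∀ y ∈ V, ∃ n, bas y n = V) :
    ∃ h : List ℕ → Mark X κ,
      (∀ m, ∀ U ∈ 𝓝 (h m).point, ∃ N, ∀ r ≥ N, (h m).nhd r ⊆ U) ∧
      ∀ m m', Encodable.encode m < Encodable.encode m' →
        IsLocated c h m m' (h m').point ∧ (h m).point ≠ (h m').point := by
  have : Nonempty X := by
    by_contra hne
    rw [not_nonempty_iff] at hne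
    exact hX ⟨fun _ _ => False, inferInstance, fun x => (hne.false x).elim⟩
  have hzero : ∃ S : Stage X κ, S.IsValid c 0 := by
    have hnil : ∀ s, IsActive 0 s → s = [] := by
      rintro (_ | ⟨a, t⟩) hs
      · rfl
      · exact absurd (hs.2 a t rfl) (Nat.not_lt_zero _)
    refine ⟨⟨fun _ => univ, fun _ => baseIdeal X,
      fun _ => ⟨Classical.arbitrary X, Classical.arbitrary κ, Classical.arbitrary κ, fun _ => ∅⟩⟩,
      fun _ _ => isNormal_baseIdeal, fun _ _ => univ_notMem_baseIdeal hX,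
      fun s t hs ht hst => absurd ((hnil s hs).trans (hnil t ht).symm) hst,
      fun m s hm => absurd hm (Nat.not_lt_zero _), fun m hm => absurd hm (Nat.not_lt_zero _),
      fun m m' _ hm => absurd hm (Nat.not_lt_zero _)⟩
  have hsucc : ∀ (n : ℕ) (S : {S : Stage X κ // S.IsValid c n}),
      ∃ S' : {S : Stage X κ // S.IsValid c (n + 1)},
        ∀ m, Encodable.encode m < n → S'.1.mark m = S.1.mark m := by
    rintro n ⟨S, hS⟩
    obtain ⟨u, rfl⟩ : ∃ u : List ℕ, Encodable.encode u = n :=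
      ⟨Denumerable.ofNat (List ℕ) n, Denumerable.encode_ofNat n⟩
    obtain ⟨S', hS', h⟩ := hS.exists_succ hbas
    exact ⟨⟨S', hS'⟩, h⟩
  choose next hnext using hsucc
  let T : ∀ n, {S : Stage X κ // S.IsValid c n} :=
    fun n => Nat.rec ⟨hzero.choose, hzero.choose_spec⟩ next n
  have hT : ∀ n m, Encodable.encode m < n →
      (T n).1.mark m = (T (Encodable.encode m + 1)).1.mark m := by
    intro n m hm
    induction n, Nat.succ_le_of_lt hm using Nat.le_induction with
    | base => rfl
    | succ n hn ih => exact (hnext n (T n) m hn).trans (ih hn)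
  refine ⟨fun m => (T (Encodable.encode m + 1)).1.mark m,
    fun m => (T _).2.nhd m (Nat.lt_succ_self _),
    fun m m' hmm' => ?_⟩
  obtain ⟨h₁, h₂⟩ := (T (Encodable.encode m' + 1)).2.pairs m m' hmm' (Nat.lt_succ_self _)
  refine ⟨h₁.congr fun w hw => (hT (Encodable.encode m' + 1) w ?_).symm, ?_⟩
  · omega
  · rwa [hT (Encodable.encode m' + 1) m (by omega)] at h₂

end Tree

/-! ### Homogeneous subtrees -/

theorem exists_dense_colour {κ : Type*} [Finite κ] (τ : List ℕ → κ) :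
    ∃ k s₀, ∀ s, s₀ <:+ s → ∃ w, s <:+ w ∧ τ w = k := by
  by_contra! H
  have hF : ∀ F : Set κ, F.Finite → ∃ s, ∀ w, s <:+ w → τ w ∉ F := by
    intro F hF
    induction F, hF using Set.Finite.induction_on with
    | empty => exact ⟨[], fun w _ => notMem_empty _⟩
    | insert _ _ ih =>
      obtain ⟨s, hs⟩ := ih
      obtain ⟨t, hst, ht⟩ := H _ s
      refine ⟨t, fun w hw hmem => ?_⟩
      rcases hmem with h | h
      · exact ht w hw h
      · exact hs w (hst.trans hw) h
  obtain ⟨s, hs⟩ := hF univ finite_univ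
  exact hs s List.suffix_rfl (mem_univ _)

/-- Every finite colouring of the tree has a homogeneous copy of the tree. -/
theorem exists_homogeneous_subtree {κ : Type*} [Finite κ] (τ : List ℕ → κ) :
    ∃ k, ∃ g : List ℕ → List ℕ, (∀ s, τ (g s) = k) ∧ ∀ r s, r :: g s <:+ g (r :: s) := by
  obtain ⟨k, s₀, hs₀⟩ := exists_dense_colour τ
  choose f hf hfk using hs₀
  let g : List ℕ → {s // s₀ <:+ s} := fun s => List.rec ⟨f s₀ List.suffix_rfl, hf _ _⟩
    (fun r _ t => ⟨f (r :: t.1) (t.2.trans (List.suffix_cons _ _)),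
      (t.2.trans (List.suffix_cons _ _)).trans (hf _ _)⟩) s
  refine ⟨k, fun s => (g s).1, fun s => ?_, fun r s => hf _ _⟩
  rcases s with _ | ⟨r, s⟩
  · exact hfk _ _
  · exact hfk _ _

theorem cons_suffix_of_cons_suffix {g : List ℕ → List ℕ} (hg : ∀ r s, r :: g s <:+ g (r :: s))
    {r : ℕ} {s t : List ℕ} (h : r :: s <:+ t) : r :: g s <:+ g t := by
  induction t with
  | nil => simp at h
  | cons b t ih =>
    rcases List.suffix_cons_iff.1 h with h | h
    · obtain ⟨rfl, rfl⟩ := List.cons.inj h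
      exact hg _ _
    · exact ((ih h).trans (List.suffix_cons _ _)).trans (hg _ _)

/-- Two distinct nodes are comparable or branch at a node. -/
theorem exists_branching : ∀ {s t : List ℕ}, s ≠ t → (∃ r, r :: s <:+ t) ∨ (∃ r, r :: t <:+ s) ∨
    ∃ m a b, a ≠ b ∧ a :: m <:+ s ∧ b :: m <:+ t := by
  have hnil : ∀ {t : List ℕ}, t ≠ [] → ∃ r, [r] <:+ t := fun {t} ht =>
    ⟨t.getLast ht, t.dropLast, List.dropLast_append_getLast ht⟩
  intro s
  induction s with
  | nil => exact fun h => Or.inl (hnil h.symm)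
  | cons a s ih =>
    intro t hne
    by_cases hst : s = t
    · exact Or.inr (Or.inl ⟨a, hst ▸ List.suffix_rfl⟩)
    rcases ih hst with ⟨r, hr⟩ | ⟨r, hr⟩ | ⟨m, x, y, hxy, hx, hy⟩
    · by_cases har : a = r
      · subst har
        obtain ⟨l, rfl⟩ := hr
        rcases l.eq_nil_or_concat with rfl | ⟨l, b, rfl⟩
        · exact absurd rfl hne
        · exact Or.inl ⟨b, l, by simp⟩
      · exact Or.inr (Or.inr ⟨s, a, r, har, List.suffix_rfl, hr⟩)
    · exact Or.inr (Or.inl ⟨r, hr.trans (List.suffix_cons _ _)⟩)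
    · exact Or.inr (Or.inr ⟨m, x, y, hxy, hx.trans (List.suffix_cons _ _), hy⟩)

section Main

variable {X : Type u} {κ : Type} [TopologicalSpace X] {c : Sym2 X → κ} {bas : X → ℕ → Set X}

/-- There is a tree of distinct points, indexed by the finite sequences, in which each point is the
limit of its children, and whose pairs have at most two colours. -/
theorem exists_two_coloured_tree [T1Space X] [FirstCountableTopology X] [Finite κ] [Nonempty κ]
    (hX : ¬ LeftSeparated X)
    (hbas : ∀ x U, IsOpen U → x ∈ U → ∃ V, IsOpen V ∧ x ∈ V ∧ V ⊆ U ∧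
      ∀ y ∈ V, ∃ n, bas y n = V) :
    ∃ (y : List ℕ → X) (p i : κ), Function.Injective y ∧
      (∀ s t, s ≠ t → c s(y s, y t) = p ∨ c s(y s, y t) = i) ∧
      ∀ s, ∀ U ∈ 𝓝 (y s), ∃ r, y (r :: s) ∈ U := by
  obtain ⟨h, hnhd, hpairs⟩ := exists_tree (c := c) hX hbas
  obtain ⟨⟨p, i⟩, g, hgk, hg⟩ := exists_homogeneous_subtree fun m => ((h m).down, (h m).across)
  have hp : ∀ s, (h (g s)).down = p := fun s => congrArg Prod.fst (hgk s)
  have hi : ∀ s, (h (g s)).across = i := fun s => congrArg Prod.snd (hgk s)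
  have hginj : Function.Injective g := by
    intro s t hst
    by_contra hne
    rcases exists_branching hne with ⟨r, hr⟩ | ⟨r, hr⟩ | ⟨m, a, b, hab, ha, hb⟩
    · exact (encode_lt_encode_of_cons_suffix (cons_suffix_of_cons_suffix hg hr)).ne
        (congrArg _ hst)
    · exact (encode_lt_encode_of_cons_suffix (cons_suffix_of_cons_suffix hg hr)).ne'
        (congrArg _ hst)
    · exact hab (eq_of_cons_suffix_of_cons_suffix (cons_suffix_of_cons_suffix hg ha)
        (hst ▸ cons_suffix_of_cons_suffix hg hb))
  have hcol : ∀ s t, Encodable.encode (g s) < Encodable.encode (g t) →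
      c s((h (g s)).point, (h (g t)).point) = p ∨ c s((h (g s)).point, (h (g t)).point) = i := by
    intro s t hlt
    have hst : s ≠ t := by
      rintro rfl
      exact lt_irrefl _ hlt
    obtain ⟨⟨h₁, h₂⟩, -⟩ := hpairs _ _ hlt
    rcases exists_branching hst with ⟨r, hr⟩ | ⟨r, hr⟩ | ⟨m, a, b, hab, ha, hb⟩
    · exact Or.inl ((h₁ r (cons_suffix_of_cons_suffix hg hr)).1.trans (hp s))
    · exact absurd (encode_lt_encode_of_cons_suffix (cons_suffix_of_cons_suffix hg hr))
        hlt.not_gt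
    · have := h₂ _ a b hab (cons_suffix_of_cons_suffix hg ha) (cons_suffix_of_cons_suffix hg hb)
      rwa [hp, hi] at this
  refine ⟨fun s => (h (g s)).point, p, i, fun s t hst => ?_, fun s t hst => ?_, fun s U hU => ?_⟩
  · by_contra hne
    rcases lt_or_gt_of_ne (Encodable.encode_injective.ne (hginj.ne hne)) with hlt | hlt
    · exact (hpairs _ _ hlt).2 hst
    · exact (hpairs _ _ hlt).2 hst.symm
  · rcases lt_or_gt_of_ne (Encodable.encode_injective.ne (hginj.ne hst)) with hlt | hlt
    · exact hcol s t hlt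
    · rw [Sym2.eq_swap]
      exact hcol t s hlt
  · obtain ⟨N, hN⟩ := hnhd (g s) U hU
    have hs := hg N s
    exact ⟨N, hN N le_rfl
      (((hpairs _ _ (encode_lt_encode_of_cons_suffix hs)).1.1 N hs).2)⟩

end Main

end Galvin

/-- Theorem D: if `X` is a regular Hausdorff space which is not left-separated and has a
point-countable basis, then for every colouring of pairs of elements of `X` into finitely
many colours there is `Y ⊆ X` homeomorphic to `ℚ` with `|c''[Y]²| ≤ 2`. -/
theorem galvin_conjecture_topological (X : Type*) [TopologicalSpace X] [T2Space X]
    [RegularSpace X] (𝔅 : Set (Set X)) (h𝔅 : TopologicalSpace.IsTopologicalBasis 𝔅)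
    (hpc : ∀ x : X, {U ∈ 𝔅 | x ∈ U}.Countable)
    (hls : ¬ LeftSeparated X)
    (K : ℕ) (hK : 0 < K) (c : Sym2 X → Fin K) :
    ∃ Y : Set X, Nonempty (↥Y ≃ₜ ℚ) ∧ (pairColours c Y).ncard ≤ 2 := by
  have : Nonempty (Fin K) := ⟨⟨0, hK⟩⟩
  have : FirstCountableTopology X := ⟨fun x =>
    Filter.HasCountableBasis.isCountablyGenerated ⟨h𝔅.nhds_hasBasis, hpc x⟩⟩
  have hne : ∀ x : X, {U ∈ 𝔅 | x ∈ U}.Nonempty := fun x =>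
    let ⟨U, hU, hx, _⟩ := h𝔅.exists_subset_of_mem_open (mem_univ x) isOpen_univ
    ⟨U, hU, hx⟩
  choose bas hbas using fun x => (hpc x).exists_eq_range (hne x)
  have hbas' : ∀ x U, IsOpen U → x ∈ U → ∃ V, IsOpen V ∧ x ∈ V ∧ V ⊆ U ∧
      ∀ y ∈ V, ∃ n, bas y n = V := fun x U hU hx => by
    obtain ⟨V, hV, hxV, hVU⟩ := h𝔅.exists_subset_of_mem_open hx hU
    refine ⟨V, h𝔅.isOpen hV, hxV, hVU, fun y hy => ?_⟩
    have : V ∈ {U ∈ 𝔅 | y ∈ U} := ⟨hV, hy⟩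
    rwa [hbas y] at this
  obtain ⟨y, p, i, hy, hcol, hlim⟩ := Galvin.exists_two_coloured_tree (c := c) hls hbas'
  refine ⟨range y, ?_, ?_⟩
  · have : Countable (range y) := (countable_range y).to_subtype
    have : T3Space (range y) := inferInstance
    have : SecondCountableTopology (range y) := inferInstance
    have := TopologicalSpace.metrizableSpace_of_t3_secondCountable (range y)
    refine nonempty_homeomorph_rat ?_
    rintro ⟨_, s, rfl⟩
    rw [← mem_closure_iff_nhdsWithin_neBot, mem_closure_iff_nhds]
    intro U hU
    obtain ⟨V, hV, hVU⟩ := mem_nhds_subtype _ _ _ |>.1 hU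
    obtain ⟨r, hr⟩ := hlim s V hV
    exact ⟨⟨y (r :: s), mem_range_self _⟩, hVU hr, fun h =>
      List.cons_ne_self r s (hy (congrArg Subtype.val h))⟩
  · refine (ncard_le_ncard (t := {p, i}) ?_ (toFinite _)).trans
      ((ncard_insert_le p {i}).trans (by rw [ncard_singleton]))
    rintro k ⟨_, ⟨s, rfl⟩, _, ⟨t, rfl⟩, hst, rfl⟩
    exact hcol s t fun h => hst (congrArg y h)
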